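/- arXiv:math-ph/0211042 — 3 statements merged into one kernel-verified Lean document; each statement's English description precedes it below -/
import Mathlib

section
/- Anderson's integral: for α, β > -1, k > 0, and fixed 1 > y_1 > y_2 > ⋯ > y_{n-1} > 0, the integral over the region 1 > x_1 > y_1 > x_2 > ⋯ > y_{n-1} > x_n > 0 of Π_{i=1}^n x_i^α (1-x_i)^β · Π_{1≤i<j≤n}(x_i - x_j) · Π_{i=1}^n Π_{j=1}^{n-1} |x_i - y_j|^{k-1} dx_1⋯dx_n equals Γ(1+α)Γ(1+β)Γ(k)^{n-1}/Γ(2+α+β+(n-1)k) · Π_{i=1}^{n-1} y_i^{α+k}(1-y_i)^{β+k} · Π_{1≤i<j≤n-1} (y_i - y_j)^{2k-1}. -/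
open MeasureTheory

namespace DA

open Polynomial in
/-- columns polynomials -/
noncomputable def q {m : ℕ} (x : Fin m → ℝ) : Fin (m+1) → ℝ[X] :=
  Fin.cons (∏ l, (X - C (x l))) (fun i => ∏ l ∈ Finset.univ.erase i, (X - C (x l)))

lemma offdiag {m : ℕ} (f : Fin m → Fin m → ℝ) :
    ∏ j, ∏ l ∈ Finset.univ.erase j, f j l = ∏ j, ∏ l ∈ Finset.Ioi j, (f j l * f l j) := by
  have := Finset.prod_prod_Ioi_mul_eq_prod_prod_off_diag (fun i j => f j i)
  rw [this]
  refine Finset.prod_congr rfl fun i _ => Finset.prod_congr ?_ fun _ _ => rfl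
  ext; simp

noncomputable def V {m : ℕ} (x : Fin m → ℝ) : ℝ := ∏ i, ∏ j ∈ Finset.Ioi i, |x i - x j|

noncomputable def Dn {m : ℕ} (a : Fin m → ℝ) (j : Fin m) : ℝ :=
  ∏ l ∈ Finset.univ.erase j, (a j - a l)

lemma abs_prod_Dn {m : ℕ} (a : Fin m → ℝ) : |∏ j, Dn a j| = V a ^ 2 := by
  unfold Dn V
  rw [offdiag, Finset.abs_prod, ← Finset.prod_pow]
  refine Finset.prod_congr rfl fun i _ => ?_
  rw [Finset.abs_prod, ← Finset.prod_pow]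
  refine Finset.prod_congr rfl fun j _ => ?_
  rw [abs_mul, abs_sub_comm (a j), sq]

lemma abs_vander {m : ℕ} (x : Fin m → ℝ) : |(Matrix.vandermonde x).det| = V x := by
  rw [Matrix.det_vandermonde, V]
  simp only [Finset.abs_prod]
  refine Finset.prod_congr rfl fun i _ => Finset.prod_congr rfl fun j _ => ?_
  rw [abs_sub_comm]

lemma V_pos {m : ℕ} (x : Fin m → ℝ) (hx : Function.Injective x) : 0 < V x := by
  refine Finset.prod_pos fun i _ => Finset.prod_pos fun j hj => ?_
  have := Finset.mem_Ioi.1 hj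
  exact abs_pos.2 (sub_ne_zero.2 fun h => this.ne (hx h))

lemma q_natDegree {m : ℕ} (x : Fin m → ℝ) (i : Fin (m+1)) : (q x i).natDegree < m + 1 := by
  refine Fin.cases ?_ (fun i => ?_) i
  · simp [q]
  · simp only [q, Fin.cons_succ]
    rw [Polynomial.natDegree_finsetProd_X_sub_C_eq_card]
    simp

noncomputable def Cm {m : ℕ} (x : Fin m → ℝ) : Matrix (Fin (m+1)) (Fin (m+1)) ℝ :=
  fun p i => (q x i).coeff p

lemma vander_mul {m : ℕ} (x : Fin m → ℝ) (b : Fin (m+1) → ℝ) :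
    Matrix.vandermonde b * Cm x = Matrix.of fun j i => (q x i).eval (b j) := by
  ext j i
  simp only [Matrix.mul_apply, Matrix.vandermonde_apply, Cm, Matrix.of_apply]
  rw [Polynomial.eval_eq_sum_range' (q_natDegree x i), ← Fin.sum_univ_eq_sum_range
    (fun p => (q x i).coeff p * b j ^ p)]
  exact Finset.sum_congr rfl fun _ _ => mul_comm _ _

lemma abs_det_Cm {m : ℕ} (x : Fin m → ℝ) (hx : Function.Injective x) : |(Cm x).det| = V x := by
  obtain ⟨b, hb⟩ := Infinite.exists_notMem_finset (Finset.univ.image x)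
  have hb' : ∀ l, b - x l ≠ 0 := fun l h => hb (by
    simp only [Finset.mem_image, Finset.mem_univ, true_and]
    exact ⟨l, by linarith⟩)
  have h1 := congrArg (fun M => |Matrix.det M|) (vander_mul x (Fin.cons b x))
  simp only [Matrix.det_mul, abs_mul, abs_vander] at h1
  have h2 : (Matrix.of fun j i => (q x i).eval ((Fin.cons b x : Fin (m+1) → ℝ) j)).det
      = (∏ l, (b - x l)) * ∏ j, Dn x j := by
    rw [Matrix.det_of_isUpperTriangular, Fin.prod_univ_succ]
    · simp [q, Polynomial.eval_prod, Dn]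
    · intro i j hij
      simp only [id] at hij
      revert hij
      refine Fin.cases ?_ (fun i => ?_) i
      · simp
      · refine Fin.cases ?_ (fun j => ?_) j
        · intro _
          simp [q, Polynomial.eval_prod, Finset.prod_eq_zero_iff, sub_eq_zero]
        · intro hij
          have : j ≠ i := by rintro rfl; exact lt_irrefl _ hij
          simp only [Matrix.of_apply, q, Fin.cons_succ, Polynomial.eval_prod]
          exact Finset.prod_eq_zero (i := i) (by simp [this.symm]) (by simp)
  rw [h2, abs_mul, abs_prod_Dn] at h1
  have h3 : V (Fin.cons b x : Fin (m+1) → ℝ) = |∏ l, (b - x l)| * V x := by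
    unfold V
    rw [Fin.prod_univ_succ]
    simp [Finset.abs_prod]
  rw [h3] at h1
  have h4 : |∏ l, (b - x l)| ≠ 0 := abs_ne_zero.2 (Finset.prod_ne_zero_iff.2 fun l _ => hb' l)
  have h5 := (V_pos x hx).ne'
  have h6 : (|∏ l, (b - x l)| * V x) * |(Cm x).det| = (|∏ l, (b - x l)| * V x) * V x := by
    rw [h1]; ring
  exact mul_left_cancel₀ (mul_ne_zero h4 h5) h6

/-- the change of variables -/
noncomputable def T {m : ℕ} (a : Fin (m+1) → ℝ) (v : Fin (m+1) → ℝ) : Fin (m+1) → ℝ :=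
  fun j => (v 0 * ∏ i : Fin m, (a j - v i.succ)) * (Dn a j)⁻¹

noncomputable def JM {m : ℕ} (a : Fin (m+1) → ℝ) (v : Fin (m+1) → ℝ) :
    Matrix (Fin (m+1)) (Fin (m+1)) ℝ :=
  fun j i => (Dn a j)⁻¹ * ((q (Fin.tail v) i).eval (a j) *
    (Fin.cons 1 (fun _ => - v 0) : Fin (m+1) → ℝ) i)

lemma abs_det_JM {m : ℕ} (a : Fin (m+1) → ℝ) (ha : Function.Injective a) (v : Fin (m+1) → ℝ)
    (hv0 : 0 < v 0) (hv : Function.Injective (Fin.tail v)) :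
    |(JM a v).det| = v 0 ^ m * V (Fin.tail v) / V a := by
  have : JM a v = Matrix.of fun j i => (Dn a j)⁻¹ * (Matrix.of fun j i =>
      (Fin.cons 1 (fun _ => - v 0) : Fin (m+1) → ℝ) i *
      (Matrix.of fun j i => (q (Fin.tail v) i).eval (a j)) j i) j i := by
    ext j i; simp [JM, mul_comm]
  rw [this, Matrix.det_mul_column, Matrix.det_mul_row, ← vander_mul, Matrix.det_mul]
  have hp := V_pos a ha
  simp only [abs_mul, abs_det_Cm _ hv, abs_vander, Finset.prod_inv_distrib, abs_inv, abs_prod_Dn]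
  rw [Fin.prod_univ_succ]
  simp [abs_pow, abs_of_pos hv0]
  field_simp

lemma T_deriv {m : ℕ} (a : Fin (m+1) → ℝ) (v : Fin (m+1) → ℝ) :
    HasFDerivAt (T a) (LinearMap.toContinuousLinearMap (Matrix.toLin' (JM a v))) v := by
  rw [hasFDerivAt_pi']
  intro j
  have h0 : HasFDerivAt (fun v : Fin (m+1) → ℝ => v 0)
    (ContinuousLinearMap.proj (R := ℝ) (φ := fun _ : Fin (m+1) => ℝ) 0) v := hasFDerivAt_apply 0 v
  have h1 : ∀ i ∈ (Finset.univ : Finset (Fin m)), HasFDerivAt (fun v : Fin (m+1) → ℝ => a j - v i.succ)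
    (-ContinuousLinearMap.proj (R := ℝ) (φ := fun _ : Fin (m+1) => ℝ) i.succ) v := fun i _ =>
      (hasFDerivAt_apply i.succ v).const_sub (a j)
  have h2 := (h0.mul (HasFDerivAt.finsetProd h1)).mul_const (Dn a j)⁻¹
  refine h2.congr_fderiv ?_
  ext w
  simp [Matrix.toLin'_apply, Matrix.mulVec, dotProduct, JM, Fin.sum_univ_succ, q,
    Polynomial.eval_prod, Fin.tail, Finset.mul_sum]
  rw [add_comm]
  congr 1
  · ring
  · congr 1
    exact Finset.sum_congr rfl fun _ _ => by ring


def R {m : ℕ} (a : Fin (m+1) → ℝ) : Set (Fin m → ℝ) :=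
  {x | ∀ i, a i.succ < x i ∧ x i < a i.castSucc}

def D {m : ℕ} (a : Fin (m+1) → ℝ) : Set (Fin (m+1) → ℝ) :=
  {v | 0 < v 0 ∧ Fin.tail v ∈ R a}

lemma Dn_eq {m : ℕ} (a : Fin (m+1) → ℝ) (j : Fin (m+1)) :
    Dn a j = ∏ i, (a j - a (j.succAbove i)) := by
  unfold Dn
  have : Finset.univ.erase j = Finset.univ.image j.succAbove := by
    rw [Fin.image_succAbove_univ]; ext; simp
  rw [this, Finset.prod_image (fun _ _ _ _ h => Fin.succAbove_right_injective h)]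

lemma R_lt {m : ℕ} {a : Fin (m+1) → ℝ} (ha : StrictAnti a) {x : Fin m → ℝ} (hx : x ∈ R a)
    {j : Fin (m+1)} {i : Fin m} (h : i.castSucc < j) : a j < x i :=
  lt_of_le_of_lt (ha.antitone (by simpa [Fin.le_def, Fin.lt_def, Nat.succ_le_iff] using h)) (hx i).1

lemma R_gt {m : ℕ} {a : Fin (m+1) → ℝ} (ha : StrictAnti a) {x : Fin m → ℝ} (hx : x ∈ R a)
    {j : Fin (m+1)} {i : Fin m} (h : j ≤ i.castSucc) : x i < a j :=
  lt_of_lt_of_le (hx i).2 (ha.antitone h)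

lemma R_anti {m : ℕ} {a : Fin (m+1) → ℝ} (ha : StrictAnti a) {x : Fin m → ℝ} (hx : x ∈ R a) :
    StrictAnti x := by
  intro i j hij
  exact lt_trans (R_gt ha hx (j := j.castSucc) le_rfl) (R_lt ha hx (by simpa using hij))

lemma w_pos {m : ℕ} {a : Fin (m+1) → ℝ} (ha : StrictAnti a) {x : Fin m → ℝ} (hx : x ∈ R a)
    (j : Fin (m+1)) : 0 < (∏ i, (a j - x i)) * (Dn a j)⁻¹ := by
  rw [Dn_eq, ← Finset.prod_inv_distrib, ← Finset.prod_mul_distrib]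
  refine Finset.prod_pos fun i _ => ?_
  rcases lt_or_ge i.castSucc j with h | h
  · rw [Fin.succAbove_of_castSucc_lt _ _ h]
    have h1 := R_lt ha hx h
    have h2 := ha h
    exact mul_pos_of_neg_of_neg (by linarith) (inv_lt_zero.2 (by linarith))
  · rw [Fin.succAbove_of_le_castSucc _ _ h]
    have h1 := R_gt ha hx h
    have h2 := ha (lt_of_le_of_lt h (Fin.castSucc_lt_succ (i := i)))
    exact mul_pos (by linarith) (inv_pos.2 (by linarith))

lemma Dn_ne {m : ℕ} {a : Fin (m+1) → ℝ} (ha : StrictAnti a) (j : Fin (m+1)) : Dn a j ≠ 0 := by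
  unfold Dn
  refine Finset.prod_ne_zero_iff.2 fun l hl => sub_ne_zero.2 fun h => ?_
  have := ha.injective h
  simp [this] at hl

lemma R_nonempty {m : ℕ} {a : Fin (m+1) → ℝ} (ha : StrictAnti a) : ∃ x, x ∈ R a :=
  ⟨fun i => (a i.succ + a i.castSucc) / 2, fun i => by
    have := ha (Fin.castSucc_lt_succ (i := i))
    constructor <;> dsimp only <;> linarith⟩

lemma prod_adj_neg {m : ℕ} {a : Fin (m+1) → ℝ} (ha : StrictAnti a) {x : Fin m → ℝ} (hx : x ∈ R a)
    (i : Fin m) : (∏ l, (a i.castSucc - x l)) * (∏ l, (a i.succ - x l)) < 0 := by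
  rw [← Finset.prod_mul_distrib, ← Finset.mul_prod_erase _ _ (Finset.mem_univ i)]
  refine mul_neg_of_neg_of_pos ?_ (Finset.prod_pos fun l hl => ?_)
  · have := hx i
    exact mul_neg_of_pos_of_neg (by linarith) (by linarith)
  · have hne : l ≠ i := Finset.ne_of_mem_erase hl
    rcases lt_or_gt_of_ne hne with h | h
    · have h1 := R_lt ha hx (i := l) (j := i.castSucc) (by simpa using h)
      have h2 := R_lt ha hx (i := l) (j := i.succ) (by
        exact lt_trans (Fin.castSucc_lt_castSucc_iff.2 h) (Fin.castSucc_lt_succ))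
      exact mul_pos_of_neg_of_neg (by linarith) (by linarith)
    · have h1 := R_gt ha hx (i := l) (j := i.castSucc) (by simpa using h.le)
      have h2 := R_gt ha hx (i := l) (j := i.succ)
        (Fin.le_def.2 (Nat.succ_le_of_lt h))
      exact mul_pos (by linarith) (by linarith)

lemma Dn_adj_neg {m : ℕ} {a : Fin (m+1) → ℝ} (ha : StrictAnti a) (i : Fin m) :
    Dn a i.castSucc * Dn a i.succ < 0 := by
  obtain ⟨x, hx⟩ := R_nonempty ha
  have h1 := w_pos ha hx i.castSucc
  have h2 := w_pos ha hx i.succ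
  have h3 := prod_adj_neg ha hx i
  have h4 := mul_pos h1 h2
  by_contra h
  push Not at h
  have h5 : 0 ≤ (Dn a i.castSucc)⁻¹ * (Dn a i.succ)⁻¹ := by
    rw [← mul_inv]; exact inv_nonneg.2 h
  have h6 := mul_nonpos_of_nonpos_of_nonneg h3.le h5
  linarith

open Polynomial in
noncomputable def P {m : ℕ} (v : Fin (m+1) → ℝ) : ℝ[X] :=
  C (v 0) * ∏ i : Fin m, (X - C (v i.succ))

open Polynomial in
lemma P_degree {m : ℕ} (v : Fin (m+1) → ℝ) : (P v).degree < ((m+1 : ℕ) : WithBot ℕ) := by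
  rw [Polynomial.degree_lt_iff_coeff_zero]
  intro k hk
  apply Polynomial.coeff_eq_zero_of_natDegree_lt
  refine lt_of_le_of_lt (Polynomial.natDegree_C_mul_le _ _) ?_
  simpa using hk

open Polynomial in
lemma P_coeff {m : ℕ} (v : Fin (m+1) → ℝ) : (P v).coeff m = v 0 := by
  rw [P, coeff_C_mul]
  have h1 : (∏ i : Fin m, (X - C (v i.succ))).Monic := monic_prod_X_sub_C _ _
  have h2 : (∏ i : Fin m, (X - C (v i.succ))).natDegree = m := by simp
  have := h1.coeff_natDegree
  rw [h2] at this
  rw [this, mul_one]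

lemma P_eval {m : ℕ} (v : Fin (m+1) → ℝ) (z : ℝ) :
    (P v).eval z = v 0 * ∏ i : Fin m, (z - v i.succ) := by
  simp [P, Polynomial.eval_prod]

lemma sum_T {m : ℕ} {a : Fin (m+1) → ℝ} (ha : StrictAnti a) (v : Fin (m+1) → ℝ) :
    ∑ j, T a v j = v 0 := by
  have := Lagrange.coeff_eq_sum (s := Finset.univ) (v := a) ha.injective.injOn (P := P v)
    (by simpa using P_degree v)
  simp only [Finset.card_univ, Fintype.card_fin, add_tsub_cancel_right, P_coeff, P_eval] at this
  rw [this]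
  rfl

lemma T_inj {m : ℕ} {a : Fin (m+1) → ℝ} (ha : StrictAnti a) : Set.InjOn (T a) (D a) := by
  intro v hv v' hv' h
  have hP : P v = P v' := by
    refine Polynomial.eq_of_degrees_lt_of_eval_index_eq (s := Finset.univ) (v := a)
      ha.injective.injOn (by simpa using P_degree v) (by simpa using P_degree v') ?_
    intro j _
    have := congrFun h j
    simp only [T] at this
    rw [P_eval, P_eval]
    exact mul_right_cancel₀ (inv_ne_zero (Dn_ne ha j)) this
  have h0 : v 0 = v' 0 := by rw [← P_coeff v, hP, P_coeff]
  funext i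
  refine Fin.cases h0 (fun i => ?_) i
  have h1 : (P v).eval (v i.succ) = 0 := by
    rw [P_eval, Finset.prod_eq_zero (Finset.mem_univ i) (sub_self _), mul_zero]
  rw [hP, P_eval] at h1
  have h2 := (mul_eq_zero.1 h1).resolve_left hv'.1.ne'
  obtain ⟨l, _, hl⟩ := Finset.prod_eq_zero_iff.1 h2
  have hl' : v i.succ = v' l.succ := sub_eq_zero.1 hl
  rcases lt_trichotomy i l with hil | hil | hil
  · have h3 := R_lt ha hv.2 (i := i) (j := l.castSucc) (by simpa using hil)
    have h4 := (hv'.2 l).2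
    simp only [Fin.tail] at h3 h4
    linarith
  · rw [hil] at hl' ⊢; exact hl'
  · have h3 := R_lt ha hv'.2 (i := l) (j := i.castSucc) (by simpa using hil)
    have h4 := (hv.2 i).2
    simp only [Fin.tail] at h3 h4
    linarith

lemma exists_root (Q : Polynomial ℝ) {b c : ℝ} (hbc : b < c) (h : Q.eval c * Q.eval b < 0) :
    ∃ x, (b < x ∧ x < c) ∧ Q.eval x = 0 := by
  have hc : ContinuousOn (fun x => Q.eval x) (Set.Icc b c) := Q.continuous.continuousOn
  rcases mul_neg_iff.1 h with h | h
  · obtain ⟨x, hx, hx'⟩ := intermediate_value_Ioo hbc.le hc ⟨h.2, h.1⟩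
    exact ⟨x, hx, hx'⟩
  · obtain ⟨x, hx, hx'⟩ := intermediate_value_Ioo' hbc.le hc ⟨h.1, h.2⟩
    exact ⟨x, hx, hx'⟩

lemma T_image {m : ℕ} {a : Fin (m+1) → ℝ} (ha : StrictAnti a) :
    T a '' D a = Set.univ.pi fun _ => Set.Ioi 0 := by
  ext t
  simp only [Set.mem_image, Set.mem_univ_pi, Set.mem_Ioi]
  constructor
  · rintro ⟨v, hv, rfl⟩ j
    have := w_pos ha hv.2 j
    simp only [Fin.tail] at this
    simp only [T]
    rw [mul_assoc]
    exact mul_pos hv.1 this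
  · intro ht
    set Q := Lagrange.interpolate Finset.univ a (fun j => t j * Dn a j) with hQ
    have hQe : ∀ j, Q.eval (a j) = t j * Dn a j := fun j =>
      Lagrange.eval_interpolate_at_node _ ha.injective.injOn (Finset.mem_univ j)
    have hQd : Q.degree < ((m+1 : ℕ) : WithBot ℕ) := by
      have := Lagrange.degree_interpolate_lt (s := Finset.univ) (v := a)
        (fun j => t j * Dn a j) ha.injective.injOn
      rw [Finset.card_univ, Fintype.card_fin] at this
      exact this
    have hroot : ∀ i : Fin m, ∃ x, (a i.succ < x ∧ x < a i.castSucc) ∧ Q.eval x = 0 := by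
      intro i
      apply exists_root _ (ha Fin.castSucc_lt_succ)
      rw [hQe, hQe]
      have := mul_neg_of_pos_of_neg (mul_pos (ht i.castSucc) (ht i.succ)) (Dn_adj_neg ha i)
      linarith
    choose x hx hx0 using hroot
    have hxR : x ∈ R a := hx
    have hne : ∀ i, a 0 - x i ≠ 0 := fun i => by
      have := R_gt ha hxR (j := 0) (i := i) (Fin.zero_le _)
      linarith
    have hpne : ∏ i, (a 0 - x i) ≠ 0 := Finset.prod_ne_zero_iff.2 fun i _ => hne i
    set c := t 0 * Dn a 0 / ∏ i, (a 0 - x i) with hc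
    have hcpos : 0 < c := by
      have h1 := inv_pos.2 (w_pos ha hxR 0)
      have := mul_pos (ht 0) h1
      rw [mul_inv, inv_inv] at this
      have h2 : c = t 0 * ((∏ i, (a 0 - x i))⁻¹ * Dn a 0) := by rw [hc]; ring
      rw [h2]; exact this
    have hQP : Q = P (Fin.cons c x) := by
      refine Polynomial.eq_of_degrees_lt_of_eval_index_eq (s := Finset.univ)
        (v := (Fin.cons (a 0) x : Fin (m+1) → ℝ)) ?_ (by simpa using hQd)
        (by simpa using P_degree _) ?_
      · apply Function.Injective.injOn
        rw [Fin.cons_injective_iff]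
        refine ⟨?_, (R_anti ha hxR).injective⟩
        rintro ⟨i, hi⟩
        exact hne i (by rw [hi, sub_self])
      · intro j _
        rw [P_eval]
        refine Fin.cases ?_ (fun i => ?_) j
        · simp only [Fin.cons_zero, Fin.cons_succ, hQe, hc]
          field_simp
        · simp only [Fin.cons_zero, Fin.cons_succ, hx0]
          rw [Finset.prod_eq_zero (Finset.mem_univ i) (sub_self _), mul_zero]
    refine ⟨Fin.cons c x, ⟨by simpa using hcpos, by simpa using hxR⟩, ?_⟩
    funext j
    have := hQe j
    rw [hQP, P_eval] at this
    simp only [T]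
    rw [this, mul_assoc, mul_inv_cancel₀ (Dn_ne ha j), mul_one]


lemma R_eq {m : ℕ} (a : Fin (m+1) → ℝ) :
    R a = Set.univ.pi fun i => Set.Ioo (a i.succ) (a i.castSucc) := by
  ext x; simp [R]

lemma R_meas {m : ℕ} (a : Fin (m+1) → ℝ) : MeasurableSet (R a) := by
  rw [R_eq]
  exact MeasurableSet.univ_pi fun _ => measurableSet_Ioo

lemma D_eq {m : ℕ} (a : Fin (m+1) → ℝ) :
    D a = (MeasurableEquiv.piFinSuccAbove (fun _ : Fin (m+1) => ℝ) 0) ⁻¹' (Set.Ioi 0 ×ˢ R a) := by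
  ext v
  simp [D, MeasurableEquiv.piFinSuccAbove, Fin.insertNthEquiv]

lemma D_meas {m : ℕ} (a : Fin (m+1) → ℝ) : MeasurableSet (D a) := by
  rw [D_eq]
  exact (MeasurableEquiv.measurable _) (measurableSet_Ioi.prod (R_meas a))

lemma int_D {m : ℕ} (a : Fin (m+1) → ℝ) (F : ℝ → ℝ) (G : (Fin m → ℝ) → ℝ) :
    ∫ v in D a, F (v 0) * G (Fin.tail v) = (∫ r in Set.Ioi 0, F r) * ∫ x in R a, G x := by
  have h := (volume_preserving_piFinSuccAbove (fun _ : Fin (m+1) => ℝ) 0).setIntegral_preimage_emb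
    (MeasurableEquiv.measurableEmbedding _) (fun z => F z.1 * G z.2) (Set.Ioi 0 ×ˢ R a)
  rw [← D_eq] at h
  rw [← setIntegral_prod_mul]
  exact h

lemma int_gamma {m : ℕ} (s : Fin m → ℝ) (hs : ∀ j, 0 < s j) :
    ∫ t in Set.univ.pi (fun _ : Fin m => Set.Ioi (0:ℝ)), ∏ j, (Real.exp (-t j) * t j ^ (s j - 1))
      = ∏ j, Real.Gamma (s j) := by
  rw [volume_pi, Measure.restrict_pi_pi,
    integral_fintype_prod_eq_prod (fun j t => Real.exp (-t) * t ^ (s j - 1))]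
  exact Finset.prod_congr rfl fun j _ => (Real.Gamma_eq_integral (hs j)).symm

lemma main1 {m : ℕ} {a : Fin (m+1) → ℝ} (ha : StrictAnti a) (s : Fin (m+1) → ℝ)
    (hs : ∀ j, 0 < s j) :
    ∏ j, Real.Gamma (s j) = Real.Gamma (∑ j, s j) *
      ∫ x in R a, V x / V a * ∏ j, ((∏ i, (a j - x i)) * (Dn a j)⁻¹) ^ (s j - 1) := by
  rw [← int_gamma s hs, ← T_image ha,
    integral_image_eq_integral_abs_det_fderiv_smul volume (D_meas a)
      (fun v _ => (T_deriv a v).hasFDerivWithinAt) (T_inj ha),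
    Real.Gamma_eq_integral (Finset.sum_pos (fun j _ => hs j) Finset.univ_nonempty), ← int_D]
  refine setIntegral_congr_fun (D_meas a) fun v hv => ?_
  have hr : 0 < v 0 := hv.1
  have hdet : (LinearMap.toContinuousLinearMap (Matrix.toLin' (JM a v))).det = (JM a v).det := by
    simp [ContinuousLinearMap.det]
  simp only [hdet, smul_eq_mul]
  rw [abs_det_JM a ha.injective v hr (R_anti ha hv.2).injective, Finset.prod_mul_distrib,
    ← Real.exp_sum, Finset.sum_neg_distrib, sum_T ha]
  have h1 : ∏ j, T a v j ^ (s j - 1) = v 0 ^ (∑ j, (s j - 1)) *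
      ∏ j, ((∏ i, (a j - Fin.tail v i)) * (Dn a j)⁻¹) ^ (s j - 1) := by
    rw [Real.rpow_sum_of_pos hr, ← Finset.prod_mul_distrib]
    refine Finset.prod_congr rfl fun j _ => ?_
    rw [← Real.mul_rpow hr.le (w_pos ha hv.2 j).le, ← mul_assoc]
    rfl
  have h2 : v 0 ^ (∑ j, s j - 1) = v 0 ^ m * v 0 ^ (∑ j, (s j - 1)) := by
    rw [← Real.rpow_natCast, ← Real.rpow_add hr]
    congr 1
    simp
    ring
  rw [h1, h2]
  ring

lemma V_Dn {m : ℕ} {a : Fin m → ℝ} (ha : StrictAnti a) (s : Fin m → ℝ) :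
    V a * ∏ j, |Dn a j| ^ (s j - 1) =
      ∏ i, ∏ j ∈ Finset.Ioi i, (a i - a j) ^ (s i + s j - 1) := by
  have h1 : ∏ j, |Dn a j| ^ (s j - 1) =
      ∏ j, ∏ l ∈ Finset.univ.erase j, |a j - a l| ^ (s j - 1) := by
    refine Finset.prod_congr rfl fun j _ => ?_
    rw [Dn, Finset.abs_prod, Real.finsetProd_rpow _ _ fun _ _ => abs_nonneg _]
  rw [h1, offdiag, V, ← Finset.prod_mul_distrib]
  refine Finset.prod_congr rfl fun i _ => ?_
  rw [← Finset.prod_mul_distrib]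
  refine Finset.prod_congr rfl fun j hj => ?_
  have hp : 0 < a i - a j := sub_pos.2 (ha (Finset.mem_Ioi.1 hj))
  rw [abs_sub_comm (a j), abs_of_pos hp, ← Real.rpow_add hp]
  nth_rw 1 [← Real.rpow_one (a i - a j)]
  rw [← Real.rpow_add hp]
  congr 1; ring

lemma main2 {m : ℕ} {a : Fin (m+1) → ℝ} (ha : StrictAnti a) (s : Fin (m+1) → ℝ)
    (hs : ∀ j, 0 < s j) :
    ∫ x in R a, V x * ∏ j, ∏ i, |x i - a j| ^ (s j - 1) =
      (∏ j, Real.Gamma (s j)) / Real.Gamma (∑ j, s j) *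
      ∏ i, ∏ j ∈ Finset.Ioi i, (a i - a j) ^ (s i + s j - 1) := by
  have hG : Real.Gamma (∑ j, s j) ≠ 0 :=
    (Real.Gamma_pos_of_pos (Finset.sum_pos (fun j _ => hs j) Finset.univ_nonempty)).ne'
  rw [main1 ha s hs, mul_div_cancel_left₀ _ hG, ← V_Dn ha, ← integral_mul_const]
  refine setIntegral_congr_fun (R_meas a) fun x hx => ?_
  have hV := (V_pos a ha.injective).ne'
  have h1 : ∏ j, ((∏ i, (a j - x i)) * (Dn a j)⁻¹) ^ (s j - 1) * |Dn a j| ^ (s j - 1) =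
      ∏ j, ∏ i, |x i - a j| ^ (s j - 1) := by
    refine Finset.prod_congr rfl fun j _ => ?_
    rw [← Real.mul_rpow (w_pos ha hx j).le (abs_nonneg _), ← abs_of_pos (w_pos ha hx j),
      ← abs_mul, inv_mul_cancel_right₀ (Dn_ne ha j), Finset.abs_prod,
      Real.finsetProd_rpow _ _ fun _ _ => abs_nonneg _]
    simp only [abs_sub_comm]
  rw [← h1, Finset.prod_mul_distrib]
  field_simp

lemma prod_Ioi_last {n : ℕ} (g : Fin (n+1) → Fin (n+1) → ℝ) :
    ∏ i, ∏ j ∈ Finset.Ioi i, g i j =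
      (∏ i : Fin n, ∏ j ∈ Finset.Ioi i, g i.castSucc j.castSucc) *
        ∏ i : Fin n, g i.castSucc (Fin.last n) := by
  rw [Fin.prod_univ_castSucc, ← Finset.prod_mul_distrib]
  have : Finset.Ioi (Fin.last n) = ∅ := by
    ext x; simp [Fin.le_last]
  rw [this, Finset.prod_empty, mul_one]
  refine Finset.prod_congr rfl fun i _ => ?_
  rw [← Finset.filter_lt_eq_Ioi, ← Finset.filter_lt_eq_Ioi, Finset.prod_filter, Finset.prod_filter,
    Fin.prod_univ_castSucc]
  simp

end DA

theorem stmt10 (n : ℕ) (α β k : ℝ) (hα : -1 < α) (hβ : -1 < β) (hk : 0 < k)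
    (y : Fin n → ℝ) (hy : StrictAnti y) (hy01 : ∀ i, 0 < y i ∧ y i < 1) :
    (∫ x in {x : Fin (n + 1) → ℝ | x 0 < 1 ∧ 0 < x (Fin.last n) ∧
        ∀ i : Fin n, x i.succ < y i ∧ y i < x i.castSucc},
      (∏ i, x i ^ α * (1 - x i) ^ β) *
        (∏ i : Fin (n + 1), ∏ j ∈ Finset.Ioi i, (x i - x j)) *
        ∏ i : Fin (n + 1), ∏ j : Fin n, |x i - y j| ^ (k - 1)) =
      Real.Gamma (1 + α) * Real.Gamma (1 + β) * Real.Gamma k ^ n /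
          Real.Gamma (2 + α + β + n * k) *
        (∏ i, y i ^ (α + k) * (1 - y i) ^ (β + k)) *
        ∏ i : Fin n, ∏ j ∈ Finset.Ioi i, (y i - y j) ^ (2 * k - 1) := by
  obtain ⟨a, hadef⟩ : ∃ a : Fin (n+2) → ℝ, a = Fin.cons 1 (Fin.snoc y 0 : Fin (n+1) → ℝ) := ⟨_, rfl⟩
  obtain ⟨s, hsdef⟩ : ∃ s : Fin (n+2) → ℝ, s = Fin.cons (β+1)
    (Fin.snoc (fun _ : Fin n => k) (α+1) : Fin (n+1) → ℝ) := ⟨_, rfl⟩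
  have a0 : a 0 = 1 := by simp [hadef]
  have al : a (Fin.last n).succ = 0 := by simp [hadef, -Fin.succ_last]
  have ay : ∀ i : Fin n, a i.castSucc.succ = y i := fun i => by simp [hadef]
  have s0 : s 0 = β + 1 := by simp [hsdef]
  have sl : s (Fin.last n).succ = α + 1 := by simp [hsdef, -Fin.succ_last]
  have sy : ∀ i : Fin n, s i.castSucc.succ = k := fun i => by simp [hsdef]
  have hs : ∀ j, 0 < s j := by
    intro j
    refine Fin.cases ?_ (fun j => Fin.lastCases ?_ (fun j => ?_) j) j
    · rw [s0]; linarith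
    · rw [sl]; linarith
    · rw [sy]; exact hk
  have ha : StrictAnti a := by
    intro i j
    refine Fin.cases ?_ (fun i => Fin.lastCases ?_ (fun i => ?_) i) i <;>
    refine Fin.cases ?_ (fun j => Fin.lastCases ?_ (fun j => ?_) j) j <;>
    simp only [a0, al, ay, Fin.succ_lt_succ_iff, Fin.castSucc_lt_castSucc_iff]
    · simp
    · simp
    · exact fun _ => (hy01 j).2
    · simp
    · simp
    · intro h; exact absurd h (by simp [Fin.le_last])
    · simp
    · exact fun _ => (hy01 i).1
    · exact fun h => hy h
  have hR : {x : Fin (n + 1) → ℝ | x 0 < 1 ∧ 0 < x (Fin.last n) ∧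
        ∀ i : Fin n, x i.succ < y i ∧ y i < x i.castSucc} = DA.R a := by
    ext x
    simp only [DA.R, Set.mem_ofPred_eq, forall_and]
    rw [Fin.forall_fin_succ' (P := fun i => a i.succ < x i),
      Fin.forall_fin_succ (P := fun i => x i < a i.castSucc)]
    simp only [Fin.castSucc_zero, a0, al, ay, ← Fin.succ_castSucc]
    tauto
  rw [hR]
  have h := DA.main2 ha s hs
  have hL : ∫ x in DA.R a, DA.V x * ∏ j, ∏ i, |x i - a j| ^ (s j - 1) =
    ∫ x in DA.R a, (∏ i, x i ^ α * (1 - x i) ^ β) *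
        (∏ i : Fin (n + 1), ∏ j ∈ Finset.Ioi i, (x i - x j)) *
        ∏ i : Fin (n + 1), ∏ j : Fin n, |x i - y j| ^ (k - 1) := by
    refine setIntegral_congr_fun (DA.R_meas a) fun x hx => ?_
    have hV : DA.V x = ∏ i : Fin (n + 1), ∏ j ∈ Finset.Ioi i, (x i - x j) := by
      refine Finset.prod_congr rfl fun i _ => Finset.prod_congr rfl fun j hj => ?_
      exact abs_of_pos (sub_pos.2 (DA.R_anti ha hx (Finset.mem_Ioi.1 hj)))
    beta_reduce
    rw [hV, Finset.prod_comm (f := fun i j => |x i - y j| ^ (k - 1)),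
      Fin.prod_univ_succ (f := fun j => ∏ i, |x i - a j| ^ (s j - 1)),
      Fin.prod_univ_castSucc (f := fun j : Fin (n+1) => ∏ i, |x i - a j.succ| ^ (s j.succ - 1))]
    simp only [a0, al, ay, s0, sl, sy, add_sub_cancel_right, Finset.prod_mul_distrib]
    have e1 : ∏ i, |x i - 1| ^ β = ∏ i, (1 - x i) ^ β := by
      refine Finset.prod_congr rfl fun i _ => ?_
      have := DA.R_gt ha hx (j := 0) (i := i) (Fin.zero_le _)
      rw [a0] at this
      rw [abs_sub_comm, abs_of_pos (by linarith)]
    have e2 : ∏ i, |x i - 0| ^ α = ∏ i, x i ^ α := by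
      refine Finset.prod_congr rfl fun i _ => ?_
      have := DA.R_lt ha hx (j := (Fin.last n).succ) (i := i) (by simp [Fin.castSucc_lt_last])
      rw [al] at this
      rw [sub_zero, abs_of_pos this]
    rw [e1, e2]
    ring
  rw [← hL, h, Fin.prod_univ_succ (f := fun j => Real.Gamma (s j)),
    Fin.prod_univ_castSucc (f := fun j : Fin (n+1) => Real.Gamma (s j.succ)), Fin.sum_univ_succ,
    Fin.sum_univ_castSucc, Fin.prod_univ_succ, Fin.prod_Ioi_zero]
  simp only [Fin.prod_Ioi_succ]
  rw [DA.prod_Ioi_last, Fin.prod_univ_castSucc (n := n)]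
  simp only [a0, al, ay, s0, sl, sy, Finset.prod_const, Finset.sum_const, Finset.card_univ,
    Fintype.card_fin, nsmul_eq_mul, sub_zero, Real.one_rpow, Finset.prod_mul_distrib]
  have e0 : β + 1 + (n * k + (α + 1)) = 2 + α + β + n * k := by ring
  have e1 : β + 1 + k - 1 = β + k := by ring
  have e2 : k + (α + 1) - 1 = α + k := by ring
  have e3 : k + k - 1 = 2 * k - 1 := by ring
  rw [e0, e1, e2, e3, add_comm β 1, add_comm α 1]
  ring
end

section
/- The Selberg integral: for Re(λ_1) > -1, Re(λ_2) > -1, λ > 0 (satisfying the standard convergence conditions), ∫_{[0,1]^N} Π_{i=1}^N t_i^{λ_1}(1-t_i)^{λ_2} Π_{1≤j<k≤N} |t_k - t_j|^{2λ} dt = Π_{j=0}^{N-1} [Γ(λ_1+1+jλ)Γ(λ_2+1+jλ)Γ(1+(j+1)λ)] / [Γ(λ_1+λ_2+2+(N+j-1)λ)Γ(1+λ)]. -/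
namespace Selb
open MeasureTheory Set Filter Topology

/-- regularised Vandermonde power -/
noncomputable def G (γ ε : ℝ) {n : ℕ} (t : Fin n → ℝ) : ℝ :=
  ∏ i, ∏ j ∈ Finset.Ioi i, ((t i - t j) ^ 2 + ε) ^ γ

lemma G_nonneg (γ ε : ℝ) (hε : 0 ≤ ε) {n : ℕ} (t : Fin n → ℝ) : 0 ≤ G γ ε t :=
  Finset.prod_nonneg fun i _ => Finset.prod_nonneg fun j _ => by positivity

lemma G_cont {γ : ℝ} (hγ : 0 ≤ γ) (ε : ℝ) {n : ℕ} : Continuous (fun t : Fin n → ℝ => G γ ε t) := by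
  unfold G
  refine continuous_finsetProd _ fun i _ => continuous_finsetProd _ fun j _ => ?_
  exact Continuous.rpow_const (by fun_prop) (fun _ => Or.inr hγ)

lemma G_cont_eps {γ : ℝ} (hγ : 0 ≤ γ) {n : ℕ} (t : Fin n → ℝ) : Continuous (fun ε : ℝ => G γ ε t) := by
  unfold G
  refine continuous_finsetProd _ fun i _ => continuous_finsetProd _ fun j _ => ?_
  exact Continuous.rpow_const (by fun_prop) (fun _ => Or.inr hγ)

lemma G_mono {γ : ℝ} (hγ : 0 ≤ γ) {ε ε' : ℝ} (h0 : 0 ≤ ε) (h : ε ≤ ε') {n : ℕ} (t : Fin n → ℝ) :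
    G γ ε t ≤ G γ ε' t := by
  unfold G
  refine Finset.prod_le_prod (fun i _ => Finset.prod_nonneg fun j _ => by positivity) fun i _ => ?_
  refine Finset.prod_le_prod (fun i _ => by positivity) fun j _ => ?_
  exact Real.rpow_le_rpow (by positivity) (by linarith) hγ

lemma G_perm (γ ε : ℝ) (hε : 0 ≤ ε) {n : ℕ} (t : Fin n → ℝ) (σ : Equiv.Perm (Fin n)) :
    G γ ε (fun i => t (σ i)) = G γ ε t := by
  have key : ∀ s : Fin n → ℝ, G γ ε s ^ 2 = ∏ i, ∏ j ∈ {i}ᶜ, ((s j - s i) ^ 2 + ε) ^ γ := by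
    intro s
    rw [← Finset.prod_prod_Ioi_mul_eq_prod_prod_off_diag
      (fun j i => ((s j - s i) ^ 2 + ε) ^ γ), G, ← Finset.prod_pow]
    refine Finset.prod_congr rfl fun i _ => ?_
    rw [← Finset.prod_pow]
    refine Finset.prod_congr rfl fun j _ => ?_
    rw [sq (_ ^ γ)]
    congr 2
    ring
  refine (sq_eq_sq₀ (G_nonneg _ _ hε _) (G_nonneg _ _ hε _)).1 ?_
  rw [key, key, ← Equiv.prod_comp σ (fun i => ∏ j ∈ {i}ᶜ, ((t j - t i) ^ 2 + ε) ^ γ)]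
  refine Finset.prod_congr rfl fun i _ => ?_
  refine Finset.prod_equiv σ ?_ ?_
  · intro j; simp
  · intro j _; rfl

lemma G_cons (γ ε : ℝ) {n : ℕ} (x : ℝ) (y : Fin n → ℝ) :
    G γ ε (Fin.cons x y : Fin (n + 1) → ℝ) = (∏ j, ((x - y j) ^ 2 + ε) ^ γ) * G γ ε y := by
  unfold G
  rw [Fin.prod_univ_succ, Fin.prod_Ioi_zero]
  simp only [Fin.prod_Ioi_succ, Fin.cons_zero, Fin.cons_succ]

lemma G_deriv (γ ε : ℝ) (hε : 0 < ε) {n : ℕ} (x : ℝ) (y : Fin n → ℝ) :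
    HasDerivAt (fun x => G γ ε (Fin.cons x y : Fin (n + 1) → ℝ))
      (∑ j, 2 * γ * ((x - y j) / ((x - y j) ^ 2 + ε) * G γ ε (Fin.cons x y : Fin (n + 1) → ℝ))) x := by
  simp only [G_cons]
  have h1 : ∀ j ∈ Finset.univ, HasDerivAt (fun x => ((x - y j) ^ 2 + ε) ^ γ)
      (2 * (x - y j) * γ * ((x - y j) ^ 2 + ε) ^ (γ - 1)) x := by
    intro j _
    have h2 : HasDerivAt (fun x => (x - y j) ^ 2 + ε) (2 * (x - y j)) x := by
      have := (((hasDerivAt_id x).sub_const (y j)).pow 2).add_const ε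
      simpa using this
    have hp : 0 < (x - y j) ^ 2 + ε := by positivity
    exact h2.rpow_const (Or.inl hp.ne')
  have h3 := (HasDerivAt.fun_finsetProd h1).mul_const (G γ ε y)
  refine h3.congr_deriv ?_
  rw [Finset.sum_mul]
  refine Finset.sum_congr rfl fun j hj => ?_
  have hp : 0 < (x - y j) ^ 2 + ε := by positivity
  rw [← Finset.prod_erase_mul _ _ hj, Real.rpow_sub_one hp.ne', smul_eq_mul]
  field_simp

section meas
variable (ν : Measure ℝ) [IsFiniteMeasure ν]

lemma int_of_cont (hν : ∀ᵐ x ∂ν, x ∈ Icc (0:ℝ) 1) {n : ℕ} {f : (Fin n → ℝ) → ℝ} (hf : Continuous f) :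
    Integrable f (Measure.pi fun _ : Fin n => ν) := by
  have hr : ν.restrict (Icc 0 1) = ν := Measure.restrict_eq_self_of_ae_mem hν
  have := Measure.restrict_pi_pi (fun _ : Fin n => ν) (fun _ => Icc (0:ℝ) 1)
  simp only [hr] at this
  rw [← this]
  exact hf.continuousOn.integrableOn_compact (isCompact_univ_pi fun _ => isCompact_Icc)

lemma int_cons (hν : ∀ᵐ x ∂ν, x ∈ Icc (0:ℝ) 1) {n : ℕ} {f : (Fin (n+1) → ℝ) → ℝ} (hf : Continuous f) :
    ∫ t, f t ∂(Measure.pi fun _ : Fin (n+1) => ν) =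
     ∫ y, ∫ x, f (Fin.cons x y : Fin (n+1) → ℝ) ∂ν ∂(Measure.pi fun _ : Fin n => ν) := by
  have e := (measurePreserving_piFinSuccAbove (fun _ : Fin (n+1) => ν) 0).symm
  have hi := int_of_cont ν hν hf
  rw [← e.integral_comp', integral_prod_symm]
  · simp [MeasurableEquiv.piFinSuccAbove_symm_apply, Fin.insertNthEquiv]
  · exact (e.integrable_comp_emb (MeasurableEquiv.measurableEmbedding _)).2 hi

lemma int_perm {n : ℕ} (f : (Fin n → ℝ) → ℝ) (σ : Equiv.Perm (Fin n)) :
    ∫ t, f (fun i => t (σ i)) ∂(Measure.pi fun _ : Fin n => ν) =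
    ∫ t, f t ∂(Measure.pi fun _ : Fin n => ν) := by
  have e := measurePreserving_piCongrLeft (fun _ : Fin n => ν) σ
  rw [← e.integral_comp']
  congr 1
  ext t
  congr 1
  ext i
  exact Equiv.piCongrLeft_apply_apply (fun _ : Fin n => ℝ) σ t i

end meas
end Selb

namespace Selb
open MeasureTheory Set Filter Topology
section meas
variable (ν : Measure ℝ) [IsFiniteMeasure ν]

lemma eps_identity (hν : ∀ᵐ x ∂ν, x ∈ Icc (0:ℝ) 1) {p q : ℝ → ℝ} (hp : Continuous p)
    (hq : Continuous q) (B : ℝ)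
    (hibp : ∀ g g' : ℝ → ℝ, (∀ x, HasDerivAt g (g' x) x) → Continuous g' →
      ∫ x, (p x * g x + q x * g' x) ∂ν = - B * g 0)
    {n : ℕ} {m : (Fin n → ℝ) → ℝ} (hm : Continuous m) {γ : ℝ} (hγ : 0 ≤ γ) {ε : ℝ} (hε : 0 < ε) :
    ∫ t, (p (t 0) * m (Fin.tail t) * G γ ε t + ∑ j : Fin n, 2 * γ * (q (t 0) * m (Fin.tail t) *
      ((t 0 - t j.succ) / ((t 0 - t j.succ) ^ 2 + ε) * G γ ε t)))
        ∂(Measure.pi fun _ : Fin (n+1) => ν) =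
    - B * ∫ y, m y * G γ ε (Fin.cons 0 y : Fin (n+1) → ℝ) ∂(Measure.pi fun _ : Fin n => ν) := by
  have htail : Continuous (fun t : Fin (n+1) → ℝ => Fin.tail t) := by
    unfold Fin.tail; fun_prop
  have hmt := hm.comp htail
  have hG := G_cont hγ ε (n := n+1)
  have hr : ∀ j : Fin n, Continuous (fun t : Fin (n+1) → ℝ =>
      (t 0 - t j.succ) / ((t 0 - t j.succ) ^ 2 + ε)) := by
    intro j
    refine Continuous.div (by fun_prop) (by fun_prop) fun t => ?_
    positivity
  rw [int_cons ν hν, ← integral_const_mul]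
  · congr 1
    ext y
    simp only [Fin.cons_zero, Fin.cons_succ, Fin.tail_cons]
    have hc : Continuous (fun x : ℝ => (Fin.cons x y : Fin (n+1) → ℝ)) := by
      refine continuous_pi fun i => ?_
      refine Fin.cases ?_ (fun i => ?_) i
      · exact continuous_id
      · simpa using continuous_const
    have h := hibp (fun x => m y * G γ ε (Fin.cons x y : Fin (n + 1) → ℝ)) _
      (fun x => (G_deriv γ ε hε x y).const_mul (m y)) ?_
    · calc _ = ∫ x, _ ∂ν := by
            congr 1
            ext x
            rw [show ∀ a b c d e: ℝ, a * (b * c) + d * e = a * b * c + d * e by intros; ring,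
              Finset.mul_sum, Finset.mul_sum]
            congr 1
            refine Finset.sum_congr rfl fun j _ => ?_
            ring
        _ = _ := h
        _ = _ := by ring
    · refine Continuous.mul continuous_const (continuous_finsetSum _ fun j _ => ?_)
      refine Continuous.mul continuous_const (Continuous.mul ?_ (hG.comp hc))
      refine Continuous.div (by fun_prop) (by fun_prop) fun t => ?_
      positivity
  · refine Continuous.add (((hp.comp (continuous_apply 0)).mul hmt).mul hG)
      (continuous_finsetSum _ fun j _ => ?_)
    exact continuous_const.mul (((hq.comp (continuous_apply 0)).mul hmt).mul ((hr j).mul hG))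

lemma symm_identity (hν : ∀ᵐ x ∂ν, x ∈ Icc (0:ℝ) 1) {n : ℕ} {γ : ℝ} (hγ : 0 ≤ γ) {ε : ℝ}
    (hε : 0 < ε) {Q H : (Fin (n+1) → ℝ) → ℝ} (hQ : Continuous Q) (j : Fin n)
    (hH : ∀ t, Q t - Q (fun i => t (Equiv.swap 0 j.succ i)) = (t 0 - t j.succ) * H t) :
    ∫ t, Q t * ((t 0 - t j.succ) / ((t 0 - t j.succ) ^ 2 + ε) * G γ ε t)
        ∂(Measure.pi fun _ : Fin (n+1) => ν) =
    (1/2) * ∫ t, H t * ((t 0 - t j.succ) ^ 2 / ((t 0 - t j.succ) ^ 2 + ε) * G γ ε t)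
        ∂(Measure.pi fun _ : Fin (n+1) => ν) := by
  set F : (Fin (n+1) → ℝ) → ℝ := fun t => 
    Q t * ((t 0 - t j.succ) / ((t 0 - t j.succ) ^ 2 + ε) * G γ ε t) with hF
  have hFc : Continuous F := by
    refine hQ.mul (Continuous.mul ?_ (G_cont hγ ε))
    refine Continuous.div (by fun_prop) (by fun_prop) fun t => ?_
    positivity
  have hFs : Continuous (fun t : Fin (n+1) → ℝ => F (fun i => t (Equiv.swap 0 j.succ i))) :=
    hFc.comp (by fun_prop)
  have h1 := int_perm ν F (Equiv.swap 0 j.succ)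
  have h2 := integral_add (int_of_cont ν hν hFc) (int_of_cont ν hν hFs)
  rw [h1] at h2
  have h3 : (∫ t, H t * ((t 0 - t j.succ) ^ 2 / ((t 0 - t j.succ) ^ 2 + ε) * G γ ε t)
        ∂(Measure.pi fun _ : Fin (n+1) => ν)) = ∫ t, (F t + F (fun i => t (Equiv.swap 0 j.succ i)))
          ∂(Measure.pi fun _ : Fin (n+1) => ν) := ?_
  · rw [h3, h2]; ring
  · congr 1
    ext t
    simp only [hF, Equiv.swap_apply_left, Equiv.swap_apply_right, G_perm γ ε hε.le]
    have e1 : (t j.succ - t 0) ^ 2 = (t 0 - t j.succ) ^ 2 := by ring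
    rw [e1]
    have := hH t
    have e2 : Q t = Q (fun i => t (Equiv.swap 0 j.succ i)) + (t 0 - t j.succ) * H t := by linarith
    rw [e2]
    ring

lemma lim1 (hν : ∀ᵐ x ∂ν, x ∈ Icc (0:ℝ) 1) {n : ℕ} {γ : ℝ} (hγ : 0 ≤ γ)
    {k : ℕ} {f : (Fin n → ℝ) → ℝ} (hf : Continuous f) {φ : (Fin n → ℝ) → (Fin k → ℝ)}
    (hφ : Continuous φ) {r : ℝ → (Fin n → ℝ) → ℝ} (hr0 : ∀ ε > 0, ∀ t, 0 ≤ r ε t)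
    (hr1 : ∀ ε > 0, ∀ t, r ε t ≤ 1) (hrc : ∀ ε > 0, Continuous (r ε))
    (hlim : ∀ t, Tendsto (fun ε => γ * (r ε t * G γ ε (φ t))) (𝓝[>] 0) (𝓝 (γ * G γ 0 (φ t)))) :
    Tendsto (fun ε => γ * ∫ t, f t * (r ε t * G γ ε (φ t)) ∂(Measure.pi fun _ : Fin n => ν))
      (𝓝[>] 0) (𝓝 (γ * ∫ t, f t * G γ 0 (φ t) ∂(Measure.pi fun _ : Fin n => ν))) := by
  simp_rw [← integral_const_mul]
  have hG1 : Continuous fun t => G γ 1 (φ t) := (G_cont hγ 1).comp hφ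
  have hev : ∀ᶠ ε : ℝ in 𝓝[>] 0, 0 < ε ∧ ε < 1 := by
    filter_upwards [Ioo_mem_nhdsGT (zero_lt_one' ℝ)] with ε hε using hε
  refine tendsto_integral_filter_of_dominated_convergence 
    (fun t => γ * (|f t| * (1 * G γ 1 (φ t)))) ?_ ?_ ?_ ?_
  · filter_upwards [hev] with ε hε
    refine Continuous.aestronglyMeasurable ?_
    exact continuous_const.mul (hf.mul ((hrc ε hε.1).mul ((G_cont hγ ε).comp hφ)))
  · filter_upwards [hev] with ε hε
    refine Eventually.of_forall fun t => ?_
    have h0 := G_nonneg γ ε hε.1.le (φ t)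
    have h1 := G_mono hγ hε.1.le hε.2.le (φ t)
    rw [Real.norm_eq_abs, abs_mul, abs_mul, abs_mul, abs_of_nonneg hγ, abs_of_nonneg h0,
      abs_of_nonneg (hr0 ε hε.1 t)]
    have := hr1 ε hε.1 t
    gcongr
  · exact int_of_cont ν hν (continuous_const.mul (hf.abs.mul (continuous_const.mul hG1)))
  · refine Eventually.of_forall fun t => ?_
    have := (hlim t).const_mul (f t)
    refine (this.congr fun ε => ?_).trans_eq ?_
    · ring
    · congr 1; ring

lemma lim2 (hν : ∀ᵐ x ∂ν, x ∈ Icc (0:ℝ) 1) {n : ℕ} {γ : ℝ} (hγ : 0 ≤ γ)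
    {k : ℕ} {f : (Fin n → ℝ) → ℝ} (hf : Continuous f) {φ : (Fin n → ℝ) → (Fin k → ℝ)}
    (hφ : Continuous φ) :
    Tendsto (fun ε => ∫ t, f t * G γ ε (φ t) ∂(Measure.pi fun _ : Fin n => ν))
      (𝓝[>] 0) (𝓝 (∫ t, f t * G γ 0 (φ t) ∂(Measure.pi fun _ : Fin n => ν))) := by
  have hG1 : Continuous fun t => G γ 1 (φ t) := (G_cont hγ 1).comp hφ
  have hev : ∀ᶠ ε : ℝ in 𝓝[>] 0, 0 < ε ∧ ε < 1 := by
    filter_upwards [Ioo_mem_nhdsGT (zero_lt_one' ℝ)] with ε hε using hε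
  refine tendsto_integral_filter_of_dominated_convergence 
    (fun t => (|f t| * (G γ 1 (φ t)))) ?_ ?_ ?_ ?_
  · filter_upwards [hev] with ε hε
    refine Continuous.aestronglyMeasurable ?_
    exact hf.mul ((G_cont hγ ε).comp hφ)
  · filter_upwards [hev] with ε hε
    refine Eventually.of_forall fun t => ?_
    have h0 := G_nonneg γ ε hε.1.le (φ t)
    have h1 := G_mono hγ hε.1.le hε.2.le (φ t)
    rw [Real.norm_eq_abs, abs_mul, abs_of_nonneg h0]
    gcongr
  · exact int_of_cont ν hν (hf.abs.mul hG1)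
  · refine Eventually.of_forall fun t => ?_
    exact (((G_cont_eps hγ (φ t)).tendsto 0).mono_left nhdsWithin_le_nhds).const_mul (f t)

lemma lim_pt {n : ℕ} {γ : ℝ} (hγ : 0 ≤ γ) (t : Fin (n+1) → ℝ) (j : Fin n) :
    Tendsto (fun ε => γ * ((t 0 - t j.succ) ^ 2 / ((t 0 - t j.succ) ^ 2 + ε) * G γ ε t)) (𝓝[>] 0)
      (𝓝 (γ * G γ 0 t)) := by
  have hG : Tendsto (fun ε => G γ ε t) (𝓝[>] 0) (𝓝 (G γ 0 t)) :=
    ((G_cont_eps hγ t).tendsto 0).mono_left nhdsWithin_le_nhds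
  rcases hγ.eq_or_lt with h | h
  · subst h; simp
  by_cases ht : t 0 = t j.succ
  · have : G γ 0 t = 0 := by
      unfold G
      rw [Finset.prod_eq_zero (Finset.mem_univ 0)]
      refine Finset.prod_eq_zero (i := j.succ) (by simp) ?_
      simp [ht, h.ne']
    simp [ht, this]
  · have hx : (t 0 - t j.succ) ^ 2 ≠ 0 := by
      have := sub_ne_zero.2 ht
      positivity
    set x := (t 0 - t j.succ) ^ 2
    have h1 : Tendsto (fun ε : ℝ => x / (x + ε)) (𝓝[>] 0) (𝓝 (x / (x + 0))) := by
      refine Tendsto.mono_left ?_ nhdsWithin_le_nhds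
      exact tendsto_const_nhds.div (tendsto_const_nhds.add tendsto_id) (by simpa using hx)
    have h2 := (h1.mul hG).const_mul γ
    simpa [div_self hx] using h2

lemma main_identity (hν : ∀ᵐ x ∂ν, x ∈ Icc (0:ℝ) 1) {p q : ℝ → ℝ} (hp : Continuous p)
    (hq : Continuous q) (B : ℝ)
    (hibp : ∀ g g' : ℝ → ℝ, (∀ x, HasDerivAt g (g' x) x) → Continuous g' →
      ∫ x, (p x * g x + q x * g' x) ∂ν = - B * g 0)
    {n : ℕ} {m : (Fin n → ℝ) → ℝ} (hm : Continuous m) {γ : ℝ} (hγ : 0 ≤ γ)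
    {H : Fin n → (Fin (n+1) → ℝ) → ℝ} (hHc : ∀ j, Continuous (H j))
    (hH : ∀ j t, q (t 0) * m (Fin.tail t) -
      q (t j.succ) * m (Fin.tail (fun i => t (Equiv.swap 0 j.succ i))) =
        (t 0 - t j.succ) * H j t) :
    ∫ t, p (t 0) * m (Fin.tail t) * G γ 0 t ∂(Measure.pi fun _ : Fin (n+1) => ν) +
      ∑ j : Fin n, γ * ∫ t, H j t * G γ 0 t ∂(Measure.pi fun _ : Fin (n+1) => ν) =
    - B * ∫ y, m y * G γ 0 (Fin.cons 0 y : Fin (n+1) → ℝ) ∂(Measure.pi fun _ : Fin n => ν) := by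
  have htail : Continuous (fun t : Fin (n+1) → ℝ => Fin.tail t) := by
    unfold Fin.tail; fun_prop
  have hmt : Continuous fun t : Fin (n+1) → ℝ => m (Fin.tail t) := hm.comp htail
  have hpm : Continuous fun t : Fin (n+1) → ℝ => p (t 0) * m (Fin.tail t) :=
    (hp.comp (continuous_apply 0)).mul hmt
  have hqm : Continuous fun t : Fin (n+1) → ℝ => q (t 0) * m (Fin.tail t) :=
    (hq.comp (continuous_apply 0)).mul hmt
  have hcons : Continuous (fun y : Fin n → ℝ => (Fin.cons 0 y : Fin (n+1) → ℝ)) := by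
    refine continuous_pi fun i => ?_
    refine Fin.cases ?_ (fun i => ?_) i
    · simpa using continuous_const
    · simpa using continuous_apply i
  have L := (lim2 ν hν hγ hm hcons).const_mul (-B)
  have R1 := lim2 ν hν hγ hpm (φ := fun t => t) continuous_id
  have R2 := tendsto_finsetSum Finset.univ (fun j _ => lim1 ν hν hγ (hHc j) (φ := fun t => t)
    continuous_id (r := fun ε t => (t 0 - t j.succ) ^ 2 / ((t 0 - t j.succ) ^ 2 + ε))
    (fun ε hε t => by positivity)
    (fun ε hε t => by
      rw [div_le_one (by positivity)]; linarith)
    (fun ε hε => Continuous.div (by fun_prop) (by fun_prop) fun t => by positivity)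
    (fun t => lim_pt hγ t j))
  refine tendsto_nhds_unique ((R1.add R2).congr' ?_) L
  filter_upwards [self_mem_nhdsWithin] with ε hε
  have hε : 0 < ε := hε
  rw [← eps_identity ν hν hp hq B hibp hm hγ hε]
  have hG := G_cont hγ ε (n := n+1)
  have hFc : ∀ j : Fin n, Continuous (fun t : Fin (n+1) → ℝ => 2 * γ * (q (t 0) * m (Fin.tail t) *
      ((t 0 - t j.succ) / ((t 0 - t j.succ) ^ 2 + ε) * G γ ε t))) := by
    intro j
    refine continuous_const.mul (hqm.mul (Continuous.mul ?_ hG))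
    refine Continuous.div (by fun_prop) (by fun_prop) fun t => ?_
    positivity
  have hpG : Continuous fun t : Fin (n+1) → ℝ => p (t 0) * m (Fin.tail t) * G γ ε t := hpm.mul hG
  rw [integral_add (int_of_cont ν hν hpG)
    (integrable_finsetSum _ fun j _ => int_of_cont ν hν (hFc j)),
    integral_finsetSum _ fun j _ => int_of_cont ν hν (hFc j)]
  congr 1
  refine Finset.sum_congr rfl fun j _ => ?_
  rw [integral_const_mul, symm_identity ν hν hγ hε hqm (H := H j) j]
  · ring
  · intro t
    have := hH j t
    simpa using this

end meas
end Selb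

namespace Selb
open MeasureTheory Set Filter Topology

noncomputable def bw (a b t : ℝ) : ℝ := t ^ (a - 1) * (1 - t) ^ (b - 1)

lemma bw_meas (a b : ℝ) : Measurable (bw a b) := by unfold bw; fun_prop

lemma bw_nonneg (a b : ℝ) {t : ℝ} (ht : t ∈ Ioo (0:ℝ) 1) : 0 ≤ bw a b t := by
  have h1 := ht.1
  have h2 : 0 < 1 - t := by linarith [ht.2]
  unfold bw; positivity

noncomputable def bm (a b : ℝ) : Measure ℝ :=
  (volume.restrict (Ioo (0:ℝ) 1)).withDensity (fun t => ENNReal.ofReal (bw a b t))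

lemma bw_int {a b : ℝ} (ha : 0 < a) (hb : 0 < b) : IntegrableOn (bw a b) (Ioo 0 1) := by
  have h := Complex.betaIntegral_convergent (u := a) (v := b) (by simpa) (by simpa)
  rw [intervalIntegrable_iff_integrableOn_Ioc_of_le (by simp)] at h
  have h2 := (h.mono_set Ioo_subset_Ioc_self).re
  refine (integrableOn_congr_fun ?_ measurableSet_Ioo).1 h2
  intro x hx
  have h1 := hx.1
  have h2 : 0 < 1 - x := by linarith [hx.2]
  have e : ((x:ℂ) ^ ((a:ℂ) - 1) * (1 - (x:ℂ)) ^ ((b:ℂ) - 1)) = ((bw a b x : ℝ) : ℂ) := by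
    unfold bw
    push_cast
    rw [Complex.ofReal_cpow h1.le, Complex.ofReal_cpow h2.le]
    push_cast
    rfl
  simp [e]

lemma bm_fin {a b : ℝ} (ha : 0 < a) (hb : 0 < b) : IsFiniteMeasure (bm a b) := by
  refine isFiniteMeasure_withDensity_ofReal ?_
  exact (bw_int ha hb).2

lemma bm_ae_Ioo (a b : ℝ) : ∀ᵐ x ∂(bm a b), x ∈ Ioo (0:ℝ) 1 :=
  (withDensity_absolutelyContinuous _ _).ae_le (ae_restrict_mem measurableSet_Ioo)

lemma bm_ae (a b : ℝ) : ∀ᵐ x ∂(bm a b), x ∈ Icc (0:ℝ) 1 :=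
  (bm_ae_Ioo a b).mono fun _ h => Ioo_subset_Icc_self h

lemma bm_ftc {a b : ℝ} (ha : 0 < a) (hb : 0 < b) {f h : ℝ → ℝ} (hf : ContinuousOn f (Icc 0 1))
    (hh : Continuous h) (hd : ∀ x ∈ Ioo (0:ℝ) 1, HasDerivAt f (bw a b x * h x) x) :
    ∫ x, h x ∂(bm a b) = f 1 - f 0 := by
  have hint : IntervalIntegrable (fun x => bw a b x * h x) volume 0 1 := by
    rw [intervalIntegrable_iff_integrableOn_Ioo_of_le zero_le_one]
    refine IntegrableOn.mul_continuousOn_of_subset (bw_int ha hb) hh.continuousOn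
      measurableSet_Ioo isCompact_Icc Ioo_subset_Icc_self
  rw [← intervalIntegral.integral_eq_sub_of_hasDerivAt_of_le zero_le_one hf hd hint,
    intervalIntegral.integral_of_le zero_le_one, integral_Ioc_eq_integral_Ioo, bm,
    integral_withDensity_eq_integral_toReal_smul (by have := bw_meas a b; fun_prop) (by simp)]
  refine setIntegral_congr_fun measurableSet_Ioo fun x hx => ?_
  simp [ENNReal.toReal_ofReal (bw_nonneg a b hx)]

lemma ibpA {a b : ℝ} (ha : 0 < a) (hb : 0 < b) (g g' : ℝ → ℝ) (hg : ∀ x, HasDerivAt g (g' x) x)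
    (hg' : Continuous g') :
    ∫ x, ((a * (1 - x) - b * x) * g x + x * (1 - x) * g' x) ∂(bm a b) = - 0 * g 0 := by
  have hgc : Continuous g := continuous_iff_continuousAt.2 fun x => (hg x).continuousAt
  rw [bm_ftc ha hb (f := fun x => x ^ a * (1 - x) ^ b * g x)]
  · simp [ha.ne', hb.ne']
  · refine Continuous.continuousOn ?_
    refine Continuous.mul (Continuous.mul ?_ ?_) hgc
    · exact continuous_id.rpow_const (fun _ => Or.inr ha.le)
    · exact Continuous.rpow_const (by fun_prop) (fun _ => Or.inr hb.le)
  · fun_prop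
  · intro x hx
    have h1 := hx.1
    have h2 : 0 < 1 - x := by linarith [hx.2]
    have d1 : HasDerivAt (fun x : ℝ => x ^ a) (a * x ^ (a - 1)) x :=
      Real.hasDerivAt_rpow_const (Or.inl h1.ne')
    have d2 : HasDerivAt (fun x : ℝ => (1 - x) ^ b) (-1 * b * (1 - x) ^ (b - 1)) x :=
      ((hasDerivAt_id x).const_sub 1).rpow_const (Or.inl h2.ne')
    refine ((d1.mul d2).mul (hg x)).congr_deriv ?_
    have e1 : x ^ a = x ^ (a - 1) * x := by rw [Real.rpow_sub_one h1.ne']; field_simp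
    have e2 : (1 - x) ^ b = (1 - x) ^ (b - 1) * (1 - x) := by
      rw [Real.rpow_sub_one h2.ne']; field_simp
    simp only [Pi.mul_apply]
    rw [bw, e1, e2]
    ring

lemma ibpB {b : ℝ} (hb : 0 < b) (g g' : ℝ → ℝ) (hg : ∀ x, HasDerivAt g (g' x) x)
    (hg' : Continuous g') :
    ∫ x, (-b * g x + (1 - x) * g' x) ∂(bm 1 b) = - 1 * g 0 := by
  have hgc : Continuous g := continuous_iff_continuousAt.2 fun x => (hg x).continuousAt
  rw [bm_ftc one_pos hb (f := fun x => (1 - x) ^ b * g x)]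
  · simp [hb.ne']
  · refine Continuous.continuousOn ?_
    refine Continuous.mul ?_ hgc
    · exact Continuous.rpow_const (by fun_prop) (fun _ => Or.inr hb.le)
  · fun_prop
  · intro x hx
    have h2 : 0 < 1 - x := by linarith [hx.2]
    have d2 : HasDerivAt (fun x : ℝ => (1 - x) ^ b) (-1 * b * (1 - x) ^ (b - 1)) x :=
      ((hasDerivAt_id x).const_sub 1).rpow_const (Or.inl h2.ne')
    refine (d2.mul (hg x)).congr_deriv ?_
    have e2 : (1 - x) ^ b = (1 - x) ^ (b - 1) * (1 - x) := by
      rw [Real.rpow_sub_one h2.ne']; field_simp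
    rw [bw, e2]
    simp
    ring

/-! product density -/

lemma lint_prod {n : ℕ} (μ : Fin n → Measure ℝ) [∀ i, SigmaFinite (μ i)] (f : ℝ → ENNReal)
    (hf : Measurable f) :
    ∫⁻ t, ∏ i, f (t i) ∂(Measure.pi μ) = ∏ i, ∫⁻ x, f x ∂(μ i) := by
  induction n with
  | zero => simp
  | succ n ih =>
    have e := (measurePreserving_piFinSuccAbove μ 0).symm
    rw [← e.lintegral_comp_emb (MeasurableEquiv.measurableEmbedding _)]
    simp only [Fin.prod_univ_succ, MeasurableEquiv.piFinSuccAbove_symm_apply, Fin.insertNthEquiv]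
    rw [← ih]
    have := lintegral_prod_mul (μ := μ 0) (ν := Measure.pi fun j : Fin n => μ j.succ) (f := f)
      (g := fun t => ∏ i, f (t i)) hf.aemeasurable
        (Measurable.aemeasurable (by fun_prop))
    simpa using this

lemma pi_bm {a b : ℝ} (ha : 0 < a) (hb : 0 < b) (n : ℕ) :
    Measure.pi (fun _ : Fin n => bm a b) =
      (volume.restrict (univ.pi fun _ : Fin n => Ioo (0:ℝ) 1)).withDensity
        (fun t => ∏ i, ENNReal.ofReal (bw a b (t i))) := by
  have := bm_fin ha hb
  refine Measure.pi_eq fun s hs => ?_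
  rw [withDensity_apply _ (MeasurableSet.univ_pi hs), volume_pi, Measure.restrict_pi_pi,
    Measure.restrict_pi_pi, lint_prod _ (fun x => ENNReal.ofReal (bw a b x)) (by have := bw_meas a b; fun_prop)]
  refine Finset.prod_congr rfl fun i _ => ?_
  rw [bm, withDensity_apply _ (hs i)]

lemma prod_toReal (a b : ℝ) {n : ℕ} {t : Fin n → ℝ} (ht : t ∈ univ.pi fun _ : Fin n => Ioo (0:ℝ) 1) :
    (∏ i, ENNReal.ofReal (bw a b (t i))).toReal = ∏ i, bw a b (t i) := by
  rw [ENNReal.toReal_prod]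
  refine Finset.prod_congr rfl fun i _ => ?_
  exact ENNReal.toReal_ofReal (bw_nonneg a b (ht i (mem_univ i)))

lemma cube_meas (n : ℕ) : MeasurableSet (univ.pi fun _ : Fin n => Ioo (0:ℝ) 1) :=
  MeasurableSet.univ_pi fun _ => measurableSet_Ioo

lemma int_pi {a b : ℝ} (ha : 0 < a) (hb : 0 < b) {n : ℕ} (f : (Fin n → ℝ) → ℝ) :
    ∫ t, f t ∂(Measure.pi fun _ : Fin n => bm a b) =
      ∫ t in (univ.pi fun _ : Fin n => Ioo (0:ℝ) 1), (∏ i, bw a b (t i)) * f t := by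
  rw [pi_bm ha hb, integral_withDensity_eq_integral_toReal_smul]
  · refine setIntegral_congr_fun (cube_meas n) fun x hx => ?_
    simp only [prod_toReal a b hx, smul_eq_mul]
  · have := bw_meas a b; fun_prop
  · refine Eventually.of_forall fun t => ?_
    exact ENNReal.prod_lt_top fun i _ => ENNReal.ofReal_lt_top

lemma integrable_pi {a b : ℝ} (ha : 0 < a) (hb : 0 < b) {n : ℕ} {f : (Fin n → ℝ) → ℝ}
    (hf : Continuous f) :
    IntegrableOn (fun t => (∏ i, bw a b (t i)) * f t) (univ.pi fun _ : Fin n => Ioo (0:ℝ) 1) := by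
  have := bm_fin ha hb
  have h := int_of_cont (bm a b) (bm_ae a b) hf
  rw [pi_bm ha hb, integrable_withDensity_iff_integrable_smul'] at h
  · refine (integrableOn_congr_fun ?_ (cube_meas n)).1 h
    intro x hx
    simp only [prod_toReal a b hx, smul_eq_mul]
  · have := bw_meas a b; fun_prop
  · refine Eventually.of_forall fun t => ?_
    exact ENNReal.prod_lt_top fun i _ => ENNReal.ofReal_lt_top

noncomputable def S (γ : ℝ) (n : ℕ) (a b : ℝ) : ℝ :=
  ∫ t, G γ 0 t ∂(Measure.pi fun _ : Fin n => bm a b)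

lemma S_nonneg (γ : ℝ) (n : ℕ) (a b : ℝ) : 0 ≤ S γ n a b :=
  integral_nonneg fun t => G_nonneg γ 0 le_rfl t

lemma S_anti {γ : ℝ} (hγ : 0 ≤ γ) (n : ℕ) {a a' b : ℝ} (ha : 0 < a) (h : a ≤ a') (hb : 0 < b) :
    S γ n a' b ≤ S γ n a b := by
  unfold S
  rw [int_pi ha hb, int_pi (ha.trans_le h) hb]
  refine setIntegral_mono_on (integrable_pi (ha.trans_le h) hb (G_cont hγ 0))
    (integrable_pi ha hb (G_cont hγ 0)) (cube_meas n) fun t ht => ?_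
  refine mul_le_mul_of_nonneg_right ?_ (G_nonneg γ 0 le_rfl t)
  refine Finset.prod_le_prod (fun i _ => bw_nonneg _ _ (ht i (mem_univ i))) fun i _ => ?_
  have hi := ht i (mem_univ i)
  have h1 := hi.1
  have h2 : 0 < 1 - t i := by linarith [hi.2]
  unfold bw
  refine mul_le_mul_of_nonneg_right ?_ (by positivity)
  exact Real.rpow_le_rpow_of_exponent_ge h1 hi.2.le (by linarith)

lemma S_shift {γ : ℝ} (n : ℕ) {a b c : ℝ} (ha : 0 < a) (hc : 0 ≤ c) (hb : 0 < b) :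
    ∫ t, (∏ i, (t i) ^ c) * G γ 0 t ∂(Measure.pi fun _ : Fin n => bm a b) = S γ n (a + c) b := by
  unfold S
  rw [int_pi ha hb, int_pi (by positivity) hb]
  refine setIntegral_congr_fun (cube_meas n) fun t ht => ?_
  rw [← mul_assoc, ← Finset.prod_mul_distrib]
  congr 1
  refine Finset.prod_congr rfl fun i _ => ?_
  have hi := ht i (mem_univ i)
  unfold bw
  rw [show a + c - 1 = (a - 1) + c by ring, Real.rpow_add hi.1]
  ring

end Selb

namespace Selb
open MeasureTheory Set Filter Topology

noncomputable def E (γ : ℝ) (n : ℕ) (a b : ℝ) (K : Finset (Fin n)) : ℝ :=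
  ∫ t, (∏ i ∈ K, t i.succ) * G γ 0 t ∂(Measure.pi fun _ : Fin (n+1) => bm a b)

noncomputable def E0 (γ : ℝ) (n : ℕ) (a b : ℝ) (K : Finset (Fin n)) : ℝ :=
  ∫ t, (t 0 * ∏ i ∈ K, t i.succ) * G γ 0 t ∂(Measure.pi fun _ : Fin (n+1) => bm a b)

lemma swap_other {n : ℕ} {i j : Fin n} (h : i ≠ j) : Equiv.swap 0 j.succ i.succ = i.succ :=
  Equiv.swap_apply_of_ne_of_ne (Fin.succ_ne_zero i) (by simpa using h)

lemma prod_swap {n : ℕ} (t : Fin (n+1) → ℝ) {j : Fin n} {K : Finset (Fin n)} (hj : j ∉ K) :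
    ∏ i ∈ K, t (Equiv.swap 0 j.succ i.succ) = ∏ i ∈ K, t i.succ := by
  refine Finset.prod_congr rfl fun i hi => ?_
  rw [swap_other]
  rintro rfl
  exact hj hi

lemma E_insert {γ : ℝ} {n : ℕ} {a b : ℝ} (ha : 0 < a) (hb : 0 < b) {K : Finset (Fin n)} {j : Fin n}
    (hj : j ∉ K) : E γ n a b (insert j K) = E0 γ n a b K := by
  have := bm_fin ha hb
  unfold E E0
  rw [← int_perm (bm a b) _ (Equiv.swap 0 j.succ)]
  congr 1
  ext t
  simp only [Finset.prod_insert hj, prod_swap t hj, Equiv.swap_apply_right, G_perm γ 0 le_rfl]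

lemma E_rec {γ : ℝ} (hγ : 0 ≤ γ) {n : ℕ} {a b : ℝ} (ha : 0 < a) (hb : 0 < b) (K : Finset (Fin n)) :
    (a + (n - K.card) * γ) * E γ n a b K = (a + b + (2 * n - K.card) * γ) * E0 γ n a b K := by
  have := bm_fin ha hb
  have hν := bm_ae a b
  have hG := G_cont hγ 0 (n := n+1)
  have hH := main_identity (bm a b) hν (p := fun x => a * (1 - x) - b * x)
    (q := fun x => x * (1 - x)) (by fun_prop) (by fun_prop) 0 (ibpA ha hb) (n := n)
    (m := fun y => ∏ i ∈ K, y i) (by fun_prop) hγ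
    (H := fun j t => if j ∈ K then - (t 0 * ∏ i ∈ K, t i.succ)
      else (∏ i ∈ K, t i.succ) * (1 - t 0 - t j.succ)) ?_ ?_
  · have I1 : Integrable (fun t : Fin (n+1) → ℝ => (∏ i ∈ K, t i.succ) * G γ 0 t)
        (Measure.pi fun _ => bm a b) :=
      int_of_cont _ hν (Continuous.mul (by fun_prop) hG)
    have I2 : Integrable (fun t : Fin (n+1) → ℝ => (t 0 * ∏ i ∈ K, t i.succ) * G γ 0 t)
        (Measure.pi fun _ => bm a b) :=
      int_of_cont _ hν (Continuous.mul (by fun_prop) hG)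
    have P1 : ∫ t, (a * (1 - t 0) - b * t 0) * (∏ i ∈ K, t i.succ) * G γ 0 t
        ∂(Measure.pi fun _ : Fin (n+1) => bm a b) = a * E γ n a b K - (a + b) * E0 γ n a b K := by
      unfold E E0
      rw [← integral_const_mul, ← integral_const_mul,
        ← integral_sub (I1.const_mul _) (I2.const_mul _)]
      congr 1; ext t; ring
    have P2 : ∀ j, ∫ t, (if j ∈ K then - (t 0 * ∏ i ∈ K, t i.succ)
      else (∏ i ∈ K, t i.succ) * (1 - t 0 - t j.succ)) * G γ 0 t
        ∂(Measure.pi fun _ : Fin (n+1) => bm a b) =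
        if j ∈ K then - E0 γ n a b K else E γ n a b K - 2 * E0 γ n a b K := by
      intro j
      split_ifs with hj
      · unfold E0
        rw [← integral_neg]
        congr 1; ext t; ring
      · have I3 : Integrable (fun t : Fin (n+1) → ℝ => (∏ i ∈ insert j K, t i.succ) * G γ 0 t)
            (Measure.pi fun _ => bm a b) :=
          int_of_cont _ hν (Continuous.mul (by fun_prop) hG)
        have : E γ n a b K - 2 * E0 γ n a b K =
          E γ n a b K - E0 γ n a b K - E γ n a b (insert j K) := by rw [E_insert ha hb hj]; ring
        rw [this]
        unfold E E0
        have I12 : Integrable (fun t : Fin (n+1) → ℝ => (∏ i ∈ K, t i.succ) * G γ 0 t -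
          (t 0 * ∏ i ∈ K, t i.succ) * G γ 0 t) (Measure.pi fun _ => bm a b) := I1.sub I2
        rw [← integral_sub I1 I2, ← integral_sub I12 I3]
        congr 1; ext t
        simp only [Finset.prod_insert hj]
        ring
    simp only [Fin.tail] at hH
    rw [P1] at hH
    simp only [P2] at hH
    rw [← Finset.mul_sum, Finset.sum_ite, Finset.sum_const, Finset.sum_const,
      Finset.filter_mem_eq_inter, Finset.univ_inter, Finset.filter_notMem_eq_sdiff,
      ← Finset.compl_eq_univ_sdiff, Finset.card_compl, nsmul_eq_mul, nsmul_eq_mul,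
      Nat.cast_sub (Finset.card_le_univ K), Fintype.card_fin] at hH
    linear_combination hH
  · intro j
    by_cases hj : j ∈ K
    · simp only [hj, if_true]; fun_prop
    · simp only [hj, if_false]; fun_prop
  · intro j t
    simp only [Fin.tail]
    split_ifs with hj
    · rw [← Finset.mul_prod_erase _ _ hj, ← Finset.mul_prod_erase K 
        (fun i => t (Equiv.swap 0 j.succ i.succ)) hj, prod_swap t (by simp),
        Equiv.swap_apply_right]
      ring
    · rw [prod_swap t hj]
      ring

lemma E_prod {γ : ℝ} (hγ : 0 ≤ γ) {n : ℕ} {a b : ℝ} (ha : 0 < a) (hb : 0 < b) (K : Finset (Fin n)) :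
    E γ n a b K * ∏ m ∈ Finset.range K.card, (a + b + (2 * n - m) * γ) =
      S γ (n+1) a b * ∏ m ∈ Finset.range K.card, (a + (n - m) * γ) := by
  induction K using Finset.induction_on with
  | empty => simp [E, S]
  | insert j K hj ih =>
    rw [Finset.card_insert_of_notMem hj, Finset.prod_range_succ, Finset.prod_range_succ,
      E_insert ha hb hj]
    have := E_rec hγ ha hb K
    linear_combination (a + (n - K.card) * γ) * ih -
      (∏ m ∈ Finset.range K.card, (a + b + (2 * n - m) * γ)) * this

lemma S_rec {γ : ℝ} (hγ : 0 ≤ γ) {n : ℕ} {a b : ℝ} (ha : 0 < a) (hb : 0 < b) :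
    S γ (n+1) (a+1) b * ∏ j ∈ Finset.range (n+1), (a + b + (n + j) * γ) =
      S γ (n+1) a b * ∏ j ∈ Finset.range (n+1), (a + j * γ) := by
  have h1 := E_prod hγ ha hb (Finset.univ : Finset (Fin n))
  have h2 := E_rec hγ ha hb (Finset.univ : Finset (Fin n))
  have h3 : E0 γ n a b Finset.univ = S γ (n+1) (a+1) b := by
    rw [← S_shift (n+1) ha zero_le_one hb, E0]
    congr 1; ext t
    simp [Fin.prod_univ_succ]
  rw [← Finset.prod_range_reflect, ← Finset.prod_range_reflect (fun j : ℕ => a + j * γ)]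
  have e1 : ∏ m ∈ Finset.range (n+1), (a + b + (n + ((n + 1 - 1 - m : ℕ) : ℝ)) * γ) =
      ∏ m ∈ Finset.range (n+1), (a + b + (2 * n - m) * γ) := by
    refine Finset.prod_congr rfl fun m hm => ?_
    rw [Nat.add_sub_cancel, Nat.cast_sub (by simpa [Nat.lt_succ_iff] using hm)]
    ring
  have e2 : ∏ m ∈ Finset.range (n+1), (a + ((n + 1 - 1 - m : ℕ) : ℝ) * γ) =
      ∏ m ∈ Finset.range (n+1), (a + (n - m) * γ) := by
    refine Finset.prod_congr rfl fun m hm => ?_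
    rw [Nat.add_sub_cancel, Nat.cast_sub (by simpa [Nat.lt_succ_iff] using hm)]
  rw [e1, e2, Finset.prod_range_succ, Finset.prod_range_succ]
  rw [Finset.card_univ, Fintype.card_fin] at h1 h2
  rw [h3] at h2
  linear_combination (a + (n - n) * γ) * h1 -
      (∏ m ∈ Finset.range n, (a + b + (2 * n - m) * γ)) * h2

lemma S_one {γ : ℝ} (hγ : 0 ≤ γ) {n : ℕ} {b : ℝ} (hb : 0 < b) :
    (b + n * γ) * S γ (n+1) 1 b = S γ n (1 + 2 * γ) b := by
  have := bm_fin one_pos hb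
  have hH := main_identity (bm 1 b) (bm_ae 1 b) (p := fun x => -b)
    (q := fun x => (1 - x)) (by fun_prop) (by fun_prop) 1 (ibpB hb) (n := n)
    (m := fun y => 1) (by fun_prop) hγ (H := fun j t => -1) (by fun_prop) (by intro j t; ring)
  have h2 : ∫ y, 1 * G γ 0 (Fin.cons 0 y : Fin (n+1) → ℝ) ∂(Measure.pi fun _ : Fin n => bm 1 b)
      = S γ n (1 + 2 * γ) b := by
    rw [← S_shift n one_pos (by positivity) hb, int_pi one_pos hb, int_pi one_pos hb]
    refine setIntegral_congr_fun (cube_meas n) fun t ht => ?_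
    rw [one_mul, G_cons]
    congr 2
    refine Finset.prod_congr rfl fun i _ => ?_
    have hi := (ht i (mem_univ i)).1
    rw [Real.rpow_mul hi.le]
    congr 1
    rw [Real.rpow_two]
    ring
  rw [h2] at hH
  simp only [mul_one, integral_const_mul, Finset.sum_const, Finset.card_univ, Fintype.card_fin,
    nsmul_eq_mul] at hH
  change _ * S γ (n+1) 1 b + n * (γ * (_ * S γ (n+1) 1 b)) = _ at hH
  linear_combination -hH

end Selb

namespace Selb
open MeasureTheory Set Filter Topology

lemma ratio_le {f Q R : ℝ → ℝ} (hf : ∀ a > 0, f (a+1) = f a * R a)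
    (hQ : ∀ a > 0, Q (a+1) = Q a * R a) (hf0 : ∀ a > 0, 0 ≤ f a) (hQ0 : ∀ a > 0, 0 < Q a)
    (hfa : ∀ a > 0, ∀ b, a ≤ b → f b ≤ f a) (hQa : ∀ a > 0, ∀ b, a ≤ b → Q b ≤ Q a)
    (hR : ∀ a > 0, 0 < R a) (hl : Tendsto R atTop (𝓝 1)) {a a' : ℝ} (ha : 0 < a) (ha' : 0 < a') :
    f a / Q a ≤ f a' / Q a' := by
  have per : ∀ a > 0, ∀ k : ℕ, f (a + k) / Q (a + k) = f a / Q a := by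
    intro a ha k
    induction k with
    | zero => simp
    | succ k ih =>
      have hp : 0 < a + k := by positivity
      push_cast
      rw [← add_assoc, hf _ hp, hQ _ hp, mul_div_mul_right _ _ (hR _ hp).ne', ih]
  have hlim : Tendsto (fun l : ℕ => (f a' / Q a') / R (a' + l)) atTop (𝓝 ((f a' / Q a') / 1)) := by
    refine tendsto_const_nhds.div (hl.comp ?_) one_ne_zero
    exact tendsto_atTop_add_const_left _ _ tendsto_natCast_atTop_atTop
  rw [div_one] at hlim
  refine ge_of_tendsto hlim ?_
  obtain ⟨l0, hl0⟩ := exists_nat_ge (a - a')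
  filter_upwards [eventually_ge_atTop l0] with l hll
  have hll' : (l0 : ℝ) ≤ l := by exact_mod_cast hll
  have h0 : 0 ≤ a' + l - a := by linarith
  have h1 := Nat.le_ceil (a' + l - a)
  have h2 := Nat.ceil_lt_add_one h0
  set k := ⌈a' + l - a⌉₊
  have hy : 0 < a' + l := by positivity
  rw [← per a ha k, ← per a' ha' l, div_div, ← hQ _ hy]
  refine div_le_div₀ (hf0 _ hy) (hfa _ hy _ (by linarith)) (hQ0 _ (by positivity))
    (hQa _ (by positivity) _ (by linarith))

lemma Gamma_cross {x y d : ℝ} (hx : 0 < x) (hxy : x ≤ y) (hd : 0 < d) :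
    Real.Gamma y / Real.Gamma (y + d) ≤ Real.Gamma x / Real.Gamma (x + d) := by
  have hy : 0 < y := by linarith
  have g1 := Real.Gamma_pos_of_pos hx
  have g2 := Real.Gamma_pos_of_pos hy
  have g3 := Real.Gamma_pos_of_pos (add_pos hx hd)
  have g4 := Real.Gamma_pos_of_pos (add_pos hy hd)
  have hc := Real.convexOn_log_Gamma
  have hD : 0 < y + d - x := by linarith
  have mx : x ∈ Ioi (0:ℝ) := hx
  have my : y + d ∈ Ioi (0:ℝ) := add_pos hy hd
  have q1 : 0 ≤ d / (y + d - x) := by positivity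
  have q2 : 0 ≤ (y - x) / (y + d - x) := div_nonneg (by linarith) hD.le
  have c1 := hc.2 mx my q1 q2 (by field_simp; ring)
  have c2 := hc.2 mx my q2 q1 (by field_simp; ring)
  simp only [smul_eq_mul, Function.comp] at c1 c2
  rw [show d / (y + d - x) * x + (y - x) / (y + d - x) * (y + d) = y by field_simp; ring] at c1
  rw [show (y - x) / (y + d - x) * x + d / (y + d - x) * (y + d) = x + d by field_simp; ring] at c2
  have hs : d / (y + d - x) + (y - x) / (y + d - x) = 1 := by field_simp; ring
  have key : Real.log (Real.Gamma y) + Real.log (Real.Gamma (x + d)) ≤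
      Real.log (Real.Gamma x) + Real.log (Real.Gamma (y + d)) := by
    calc _ ≤ (d / (y + d - x) + (y - x) / (y + d - x)) *
          (Real.log (Real.Gamma x) + Real.log (Real.Gamma (y + d))) := by linarith
      _ = _ := by rw [hs, one_mul]
  rw [div_le_div_iff₀ g4 g3]
  rw [← Real.log_mul g2.ne' g3.ne', ← Real.log_mul g1.ne' g4.ne'] at key
  exact (Real.log_le_log_iff (by positivity) (by positivity)).1 key

noncomputable def Q (γ : ℝ) (n : ℕ) (b a : ℝ) : ℝ :=
  ∏ j ∈ Finset.range (n+1), Real.Gamma (a + j * γ) / Real.Gamma (a + b + (n + j) * γ)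

lemma S_ratio {γ : ℝ} (hγ : 0 ≤ γ) (n : ℕ) {b : ℝ} (hb : 0 < b) {a a' : ℝ} (ha : 0 < a)
    (ha' : 0 < a') :
    S γ (n+1) a b / Q γ n b a ≤ S γ (n+1) a' b / Q γ n b a' := by
  refine ratio_le (f := fun a => S γ (n+1) a b) (Q := Q γ n b)
    (R := fun a => ∏ j ∈ Finset.range (n+1), ((a + j * γ) / (a + b + (n + j) * γ))) ?_ ?_ ?_ ?_ ?_ ?_
    ?_ ?_ ha ha'
  · intro a ha
    have := S_rec hγ (n := n) ha hb
    have hp : (∏ j ∈ Finset.range (n+1), (a + b + (n + j) * γ)) ≠ 0 :=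
      Finset.prod_ne_zero_iff.2 fun j _ => by positivity
    simp only [Finset.prod_div_distrib]
    rw [← mul_div_assoc, eq_div_iff hp]
    exact this
  · intro a ha
    unfold Q
    rw [← Finset.prod_mul_distrib]
    refine Finset.prod_congr rfl fun j _ => ?_
    have h1 : 0 < a + j * γ := by positivity
    have h2 : 0 < a + b + (n + j) * γ := by positivity
    rw [show a + 1 + j * γ = a + j * γ + 1 by ring,
      show a + 1 + b + (n + j) * γ = a + b + (n + j) * γ + 1 by ring, Real.Gamma_add_one h1.ne',
      Real.Gamma_add_one h2.ne']
    have := Real.Gamma_pos_of_pos h2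
    field_simp
  · intro a ha; exact S_nonneg _ _ _ _
  · intro a ha
    refine Finset.prod_pos fun j _ => div_pos ?_ ?_ <;> exact Real.Gamma_pos_of_pos (by positivity)
  · intro a ha c hc
    exact S_anti hγ _ ha hc hb
  · intro a ha c hc
    have hc0 : 0 < c := by linarith
    refine Finset.prod_le_prod (fun j _ => (div_pos ?_ ?_).le) fun j _ => ?_
    · exact Real.Gamma_pos_of_pos (by positivity)
    · exact Real.Gamma_pos_of_pos (by positivity)
    · have := Gamma_cross (x := a + j * γ) (y := c + j * γ) (d := b + n * γ) (by positivity)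
        (by linarith) (by positivity)
      rwa [show c + j * γ + (b + n * γ) = c + b + (n + j) * γ by ring,
        show a + j * γ + (b + n * γ) = a + b + (n + j) * γ by ring] at this
  · intro a ha
    refine Finset.prod_pos fun j _ => by positivity
  · rw [show (1:ℝ) = ∏ j ∈ Finset.range (n+1), (1:ℝ) by simp]
    refine tendsto_finsetProd _ fun j _ => ?_
    have h : Tendsto (fun a : ℝ => 1 - (b + n * γ) / (a + (b + (n + j) * γ))) atTop (𝓝 (1 - 0)) := by
      refine tendsto_const_nhds.sub (tendsto_const_nhds.div_atTop ?_)
      exact tendsto_atTop_add_const_right _ _ tendsto_id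
    rw [sub_zero] at h
    refine h.congr' ?_
    filter_upwards [eventually_gt_atTop 0] with a ha
    have h2 : a + (b + (n + j) * γ) ≠ 0 := by positivity
    have h3 : a + b + (n + j) * γ ≠ 0 := by positivity
    field_simp
    ring

noncomputable def P (γ : ℝ) (n : ℕ) (a b : ℝ) : ℝ :=
  ∏ j ∈ Finset.range n, Real.Gamma (a + j * γ) * Real.Gamma (b + j * γ) *
    Real.Gamma (1 + (j + 1) * γ) / (Real.Gamma (a + b + ((n : ℝ) + j - 1) * γ) * Real.Gamma (1 + γ))

lemma P_one {γ : ℝ} (hγ : 0 ≤ γ) (n : ℕ) {b : ℝ} (hb : 0 < b) :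
    (b + n * γ) * P γ (n+1) 1 b = P γ n (1 + 2 * γ) b := by
  let A : ℕ → ℝ := fun j => Real.Gamma (1 + j * γ)
  let B : ℕ → ℝ := fun j => Real.Gamma (b + j * γ)
  let D : ℕ → ℝ := fun j => Real.Gamma (1 + b + (n + j) * γ)
  have hA : ∀ j, 0 < A j := fun j => Real.Gamma_pos_of_pos (by positivity)
  have hB : ∀ j, 0 < B j := fun j => Real.Gamma_pos_of_pos (by positivity)
  have hD : ∀ j, 0 < D j := fun j => Real.Gamma_pos_of_pos (by positivity)
  have e1 : P γ (n+1) 1 b = ∏ j ∈ Finset.range (n+1), A j * B j * A (j+1) / (D j * A 1) := by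
    refine Finset.prod_congr rfl fun j _ => ?_
    simp only [A, B, D]
    push_cast
    congr 3 <;> ring_nf
  have e2 : P γ n (1 + 2 * γ) b =
      ∏ j ∈ Finset.range n, A (j+2) * B j * A (j+1) / (D (j+1) * A 1) := by
    refine Finset.prod_congr rfl fun j _ => ?_
    simp only [A, B, D]
    push_cast
    congr 3 <;> ring_nf
  have e3 : D 0 = (b + n * γ) * B n := by
    simp only [B, D]
    rw [← Real.Gamma_add_one (by positivity)]
    congr 1
    push_cast
    ring
  have e4 : A 0 = 1 := by simp [A]
  rw [e1, e2]
  simp only [Finset.prod_div_distrib, Finset.prod_mul_distrib]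
  rw [Finset.prod_range_succ' A, Finset.prod_range_succ' D, Finset.prod_range_succ B,
    Finset.prod_range_succ' (fun j => A (j+1)), e3, e4, Finset.prod_range_succ (fun _ => A 1)]
  have p1 : 0 < ∏ j ∈ Finset.range n, D (j+1) := Finset.prod_pos fun j _ => hD _
  have p2 : 0 < ∏ j ∈ Finset.range n, A 1 := Finset.prod_pos fun j _ => hA _
  have := hA 1
  have := hB n
  have : 0 < b + n * γ := by positivity
  simp only [zero_add]
  field_simp

lemma P_Q {γ : ℝ} (n : ℕ) {a b : ℝ} :
    P γ (n+1) a b = Q γ n b a * ∏ j ∈ Finset.range (n+1), (Real.Gamma (b + j * γ) *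
      Real.Gamma (1 + (j + 1) * γ) / Real.Gamma (1 + γ)) := by
  unfold P Q
  rw [← Finset.prod_mul_distrib]
  refine Finset.prod_congr rfl fun j _ => ?_
  push_cast
  rw [show (n : ℝ) + 1 + j - 1 = n + j by ring]
  ring

theorem S_eq {γ : ℝ} (hγ : 0 ≤ γ) (n : ℕ) {a b : ℝ} (ha : 0 < a) (hb : 0 < b) :
    S γ n a b = P γ n a b := by
  induction n generalizing a with
  | zero => 
    have := bm_fin ha hb
    simp [S, P, G, Measure.real]
  | succ n ih =>
    have h1 : S γ (n+1) 1 b = P γ (n+1) 1 b := by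
      have e1 := S_one hγ (n := n) hb
      have e2 := P_one hγ n hb
      have hp : 0 < b + n * γ := by positivity
      rw [ih (by positivity), ← e2] at e1
      exact mul_left_cancel₀ hp.ne' e1
    have h2 := le_antisymm (S_ratio hγ n hb ha one_pos) (S_ratio hγ n hb one_pos ha)
    have hQ : ∀ a > 0, 0 < Q γ n b a := fun a ha =>
      Finset.prod_pos fun j _ => div_pos (Real.Gamma_pos_of_pos (by positivity))
        (Real.Gamma_pos_of_pos (by positivity))
    rw [h1, P_Q, mul_div_cancel_left₀ _ (hQ 1 one_pos).ne', div_eq_iff (hQ a ha).ne'] at h2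
    rw [h2, P_Q, mul_comm]

end Selb

open MeasureTheory

/-- The Selberg integral. -/
theorem stmt11 (N : ℕ) (l₁ l₂ lam : ℝ) (h1 : -1 < l₁) (h2 : -1 < l₂) (hl : 0 ≤ lam) :
    (∫ t in {t : Fin N → ℝ | ∀ i, t i ∈ Set.Icc (0 : ℝ) 1},
      (∏ i, t i ^ l₁ * (1 - t i) ^ l₂) *
        ∏ i : Fin N, ∏ j ∈ Finset.Ioi i, |t j - t i| ^ (2 * lam)) =
    ∏ j ∈ Finset.range N,
      Real.Gamma (l₁ + 1 + j * lam) * Real.Gamma (l₂ + 1 + j * lam) *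
          Real.Gamma (1 + (j + 1) * lam) /
        (Real.Gamma (l₁ + l₂ + 2 + ((N : ℝ) + j - 1) * lam) * Real.Gamma (1 + lam)) := by
  have ha : 0 < l₁ + 1 := by linarith
  have hb : 0 < l₂ + 1 := by linarith
  have h := Selb.S_eq hl N ha hb
  unfold Selb.P at h
  rw [show l₁ + 1 + (l₂ + 1) = l₁ + l₂ + 2 by ring] at h
  rw [← h, Selb.S, Selb.int_pi ha hb]
  have hset : {t : Fin N → ℝ | ∀ i, t i ∈ Set.Icc (0 : ℝ) 1} =
      Set.univ.pi fun _ : Fin N => Set.Icc (0:ℝ) 1 := by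
    ext t; simp only [Set.mem_ofPred_eq, Set.mem_univ_pi]
  have hm : (volume : Measure (Fin N → ℝ)).restrict (Set.univ.pi fun _ : Fin N => Set.Icc (0:ℝ) 1) =
      volume.restrict (Set.univ.pi fun _ : Fin N => Set.Ioo (0:ℝ) 1) := by
    rw [volume_pi, Measure.restrict_pi_pi, Measure.restrict_pi_pi]
    congr 1
    ext1 i
    exact (Measure.restrict_congr_set Ioo_ae_eq_Icc).symm
  rw [hset, hm]
  congr 1
  ext t
  unfold Selb.G Selb.bw
  simp only [add_sub_cancel_right, add_zero]
  congr 1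
  refine Finset.prod_congr rfl fun i _ => Finset.prod_congr rfl fun j _ => ?_
  rw [Real.rpow_mul (abs_nonneg _), Real.rpow_two, sq_abs]
  congr 1
  ring
end

section
/- Let n ≥ 2 and consider the measure on ordered tuples h_1 > h_2 > ⋯ > h_n ≥ 0 of nonnegative integers proportional to z^{Σ_j h_j} α^{Σ_j (-1)^{j-1} h_j} Π_{1≤i<j≤n} (t^{h_j} - t^{h_i}) with 0 < t < 1, 0 < z < 1, 0 < αz < 1, z² t < 1 appropriately. Summing over the odd-labelled coordinates h_1, h_3, … yields a marginal distribution of the even-labelled coordinates h_2, h_4, … that is independent of α; explicitly, the sum is supported (after normalization) on configurations with h_{2j-1} = h_{2j}+1 at α = 0 and the α-dependence cancels against the normalization constant. -/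
open scoped Classical

/-- The (unnormalized) weight
`z^{Σ h_j} α^{Σ (-1)^{j-1} h_j} Π_{i<j} (t^{h_j} - t^{h_i})`
on decreasing tuples of nonnegative integers. -/
noncomputable def weight13 (n : ℕ) (z t α : ℝ) (h : Fin n → ℕ) : ℝ :=
  z ^ (∑ j, h j) * α ^ (∑ j : Fin n, (-1 : ℤ) ^ (j : ℕ) * (h j : ℤ)) *
    ∏ i : Fin n, ∏ j ∈ Finset.Ioi i, (t ^ h j - t ^ h i)

noncomputable def ext13 (n : ℕ) (e : Fin (n / 2) → ℕ) (j : ℕ) : ℕ :=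
  if h : j < n / 2 then e ⟨j, h⟩ else 0

noncomputable def lo13 (n : ℕ) (e : Fin (n / 2) → ℕ) (i : ℕ) : ℕ :=
  if i % 2 = 1 then ext13 n e (i / 2) else if i + 1 < n then ext13 n e (i / 2) + 1 else 0

noncomputable def hi13 (n : ℕ) (e : Fin (n / 2) → ℕ) (i : ℕ) : ℕ :=
  if i % 2 = 1 then lo13 n e i + 1 else lo13 n e (i - 1)

noncomputable def co13 (z α : ℝ) (i : ℕ) : ℝ := if i % 2 = 1 then z / α else α * z

noncomputable def A13 (n : ℕ) (e : Fin (n / 2) → ℕ) (m : ℕ) (i : Fin n) : Finset ℕ :=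
  if (i : ℕ) = 0 then (if lo13 n e 0 ≤ m then {m} else ∅)
  else Finset.Ico (lo13 n e i) (hi13 n e i)

theorem co13_ne (z α : ℝ) (hz : 0 < z) (hα : 0 < α) (i : ℕ) : co13 z α i ≠ 0 := by
  unfold co13; split_ifs <;> positivity

theorem weight13_prod (n : ℕ) (z t α : ℝ) (hα : 0 < α) (h : Fin n → ℕ) :
    weight13 n z t α h = (∏ i : Fin n, co13 z α i ^ h i) *
      (Matrix.vandermonde (fun i => t ^ h i)).det := by
  unfold weight13
  rw [Matrix.det_vandermonde]
  congr 1
  have h1 : ∀ s : Finset (Fin n), z ^ (∑ j ∈ s, h j) *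
      α ^ (∑ j ∈ s, (-1 : ℤ) ^ (j : ℕ) * (h j : ℤ)) = ∏ i ∈ s, co13 z α i ^ h i := by
    intro s
    induction s using Finset.induction_on with
    | empty => simp
    | insert a s ha ih =>
      rw [Finset.sum_insert ha, Finset.sum_insert ha, Finset.prod_insert ha, ← ih, pow_add,
        zpow_add₀ hα.ne']
      have : co13 z α a ^ h a = z ^ h a * α ^ ((-1 : ℤ) ^ (a : ℕ) * (h a : ℤ)) := by
        unfold co13
        split_ifs with hp
        · rw [(Nat.odd_iff.mpr hp).neg_one_pow, div_pow, neg_one_mul, zpow_neg, zpow_natCast]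
          rfl
        · rw [(Nat.even_iff.mpr (by omega)).neg_one_pow, mul_pow, one_mul, zpow_natCast]
          ring
      rw [this]; ring
  exact h1 Finset.univ

theorem weight13_det (n : ℕ) (z t α : ℝ) (hα : 0 < α) (h : Fin n → ℕ) :
    weight13 n z t α h =
      (Matrix.of fun i k : Fin n => co13 z α i ^ h i * (t ^ h i) ^ (k : ℕ)).det := by
  rw [weight13_prod n z t α hα, ← Matrix.det_mul_column]
  rfl

theorem weight13_nonneg (n : ℕ) (z t α : ℝ) (ht : 0 < t) (ht1 : t < 1) (hz : 0 < z)
    (hα : 0 < α) (h : Fin n → ℕ) (hh : StrictAnti h) : 0 ≤ weight13 n z t α h := by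
  unfold weight13
  refine mul_nonneg (by positivity) (Finset.prod_nonneg fun i _ => Finset.prod_nonneg ?_)
  intro j hj
  have := hh (Finset.mem_Ioi.mp hj)
  have := pow_le_pow_of_le_one ht.le ht1.le this.le
  linarith

theorem altsum13 (f : ℕ → ℕ) (m : ℕ) (hf : ∀ j < m, f (2 * j) = f (2 * j + 1) + 1) :
    ∑ i ∈ Finset.range (2 * m), (-1 : ℤ) ^ i * (f i : ℤ) = m := by
  induction m with
  | zero => simp
  | succ m ih =>
    rw [show 2 * (m + 1) = 2 * m + 1 + 1 by ring, Finset.sum_range_succ, Finset.sum_range_succ,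
      ih (fun j hj => hf j (by omega)), hf m (by omega), pow_succ, pow_mul]
    simp
    ring

theorem weight13_lo (n : ℕ) (z t α : ℝ) (e : Fin (n / 2) → ℕ) :
    weight13 n z t α (fun i => lo13 n e i) =
      α ^ (n / 2) * weight13 n z t 1 (fun i => lo13 n e i) := by
  unfold weight13
  have : ∑ j : Fin n, (-1 : ℤ) ^ (j : ℕ) * ((lo13 n e j : ℕ) : ℤ) = (n / 2 : ℕ) := by
    rw [Finset.sum_range (n := n) (fun i => (-1 : ℤ) ^ i * ((lo13 n e i : ℕ) : ℤ)) |>.symm]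
    have key := altsum13 (lo13 n e) (n / 2) (by
      intro j hj
      unfold lo13
      rw [if_neg (by omega), if_pos (by omega), if_pos (by omega)]
      congr 2; omega)
    rcases Nat.mod_two_eq_zero_or_one n with hn | hn
    · have : Finset.range n = Finset.range (2 * (n / 2)) := by congr 1; omega
      rw [this, key]
    · have h0 : lo13 n e (2 * (n / 2)) = 0 := by
        unfold lo13
        rw [if_neg (by omega), if_neg (by omega)]
      have : Finset.range n = Finset.range (2 * (n / 2) + 1) := by congr 1; omega
      rw [this, Finset.sum_range_succ, key, h0]; simp
  rw [this]
  simp only [zpow_natCast, one_pow]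
  ring

theorem mem_A13 (N : ℕ) (hN : 1 ≤ N) (e : Fin ((N + 1) / 2) → ℕ) (m : ℕ)
    (h : Fin (N + 1) → ℕ) :
    h ∈ Fintype.piFinset (A13 (N + 1) e m) ↔ (StrictAnti h ∧ (∀ i : Fin ((N + 1) / 2),
            h ⟨2 * (i : ℕ) + 1, by have := i.isLt; omega⟩ = e i)) ∧ h 0 = m := by
  rw [Fintype.mem_piFinset, Fin.strictAnti_iff_succ_lt]
  have hext : ∀ (j : ℕ) (hj : j < (N + 1) / 2), ext13 (N + 1) e j = e ⟨j, hj⟩ := by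
    intro j hj; simp [ext13, hj]
  constructor
  · intro H
    have h0 : h 0 = m ∧ lo13 (N + 1) e 0 ≤ m := by
      have := H 0
      simp only [A13, Fin.val_zero, if_true] at this
      split_ifs at this with hc
      · simp at this; exact ⟨this, hc⟩
      · simp at this
    have hge : ∀ i : Fin (N + 1), lo13 (N + 1) e i ≤ h i := by
      intro i
      have := H i
      by_cases hi : (i : ℕ) = 0
      · have : i = 0 := Fin.ext hi
        subst this
        rw [h0.1]; exact h0.2
      · rw [A13, if_neg hi, Finset.mem_Ico] at this
        exact this.1
    have hlt : ∀ i : Fin (N + 1), (i : ℕ) ≠ 0 → h i < hi13 (N + 1) e i := by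
      intro i hi
      have := H i
      rw [A13, if_neg hi, Finset.mem_Ico] at this
      exact this.2
    have hodd : ∀ i : Fin (N + 1), (i : ℕ) % 2 = 1 → h i = ext13 (N + 1) e (i / 2) := by
      intro i hi
      have h1 := hge i
      have h2 := hlt i (by omega)
      simp only [hi13, lo13, hi, if_true] at h1 h2
      omega
    refine ⟨⟨?_, ?_⟩, h0.1⟩
    · intro i
      have hi := i.isLt
      rcases Nat.mod_two_eq_zero_or_one (i : ℕ) with hp | hp
      · have h1 := hge i.castSucc
        have h2 := hodd i.succ (by simp; omega)
        simp only [lo13, Fin.val_castSucc, Fin.val_succ] at h1 h2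
        rw [if_neg (by omega), if_pos (by omega)] at h1
        rw [h2, show ((i : ℕ) + 1) / 2 = (i : ℕ) / 2 by omega]
        omega
      · have h1 := hlt i.succ (by simp)
        have h2 := hodd i.castSucc (by simpa using hp)
        simp only [hi13, lo13, Fin.val_castSucc, Fin.val_succ] at h1 h2
        rw [if_neg (by omega), if_pos (by omega)] at h1
        rw [h2]
        simpa using h1
    · intro i
      have hi := i.isLt
      rw [hodd _ (by show (2 * (i : ℕ) + 1) % 2 = 1; omega), ← hext i i.isLt]
      congr 1
      show (2 * (i : ℕ) + 1) / 2 = i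
      omega
  · rintro ⟨⟨hs, he⟩, h0⟩ i
    have hodd : ∀ (i : ℕ) (hi : i < N + 1), i % 2 = 1 → ext13 (N + 1) e (i / 2) = h ⟨i, hi⟩ := by
      intro i hi hp
      rw [hext (i / 2) (by omega), ← he]
      congr 1
      ext; simp; omega
    have hev : ∀ (i : ℕ) (hi : i < N + 1), i % 2 = 0 → lo13 (N + 1) e i ≤ h ⟨i, hi⟩ := by
      intro i hi hp
      unfold lo13
      rw [if_neg (by omega)]
      split_ifs with hc
      · have := hodd (i + 1) hc (by omega)
        rw [show (i + 1) / 2 = i / 2 by omega] at this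
        rw [this]
        exact hs ⟨i, by omega⟩
      · omega
    unfold A13
    split_ifs with hi hc
    · have : i = 0 := Fin.ext hi
      subst this; simp [h0]
    · exact absurd (h0 ▸ hev 0 (by omega) rfl) hc
    · rw [Finset.mem_Ico]
      have hi2 := i.isLt
      rcases Nat.mod_two_eq_zero_or_one (i : ℕ) with hp | hp
      · refine ⟨hev i i.isLt hp, ?_⟩
        unfold hi13 lo13
        rw [if_neg (by omega), if_pos (by omega), hodd (i - 1) (by omega) (by omega)]
        have := hs ⟨(i : ℕ) - 1, by omega⟩
        have e1 : (⟨(i : ℕ) - 1, by omega⟩ : Fin N).succ = i := by ext; simp; omega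
        rw [e1] at this
        exact this
      · have := hodd i i.isLt hp
        simp only [hi13, lo13, hp, if_true, this]
        simp

noncomputable def M13 (N : ℕ) (z t α : ℝ) (e : Fin ((N + 1) / 2) → ℕ)
    (r : Fin (N + 1) → ℝ) : Matrix (Fin (N + 1)) (Fin (N + 1)) ℝ :=
  Matrix.of fun i k => if (i : ℕ) = 0 then r k else
    ∑ x ∈ Finset.Ico (lo13 (N + 1) e i) (hi13 (N + 1) e i),
      co13 z α i ^ x * (t ^ x) ^ (k : ℕ)

theorem sum13_m (N : ℕ) (z t α : ℝ) (hα : 0 < α)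
    (e : Fin ((N + 1) / 2) → ℕ) (m : ℕ) :
    ∑ h ∈ Fintype.piFinset (A13 (N + 1) e m), weight13 (N + 1) z t α h =
      (M13 N z t α e (fun k => if lo13 (N + 1) e 0 ≤ m then (α * z * t ^ (k : ℕ)) ^ m else 0)).det
      := by
  have := (Matrix.detRowAlternating (n := Fin (N + 1)) (R := ℝ)).toMultilinearMap.map_sum_finset
    (fun i (x : ℕ) => fun k : Fin (N + 1) => co13 z α i ^ x * (t ^ x) ^ (k : ℕ))
    (A13 (N + 1) e m)
  rw [Finset.sum_congr rfl (fun h _ => weight13_det (N + 1) z t α hα h)]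
  refine this.symm.trans ?_
  change Matrix.det _ = _
  congr 1
  ext i k
  simp only [M13, Matrix.of_apply, A13, Finset.sum_apply]
  split_ifs with h1 h2
  · simp only [Finset.sum_singleton, h1, co13]
    simp only [Nat.zero_mod, zero_ne_one, if_false]
    rw [mul_pow _ (t ^ (k : ℕ)), ← pow_mul, ← pow_mul, mul_comm m]
  · simp
  · rfl

theorem geo13 (a : ℝ) (ha0 : 0 ≤ a) (ha1 : a < 1) (l : ℕ) :
    HasSum (fun m : ℕ => if l ≤ m then a ^ m else 0) (a ^ l / (1 - a)) := by
  have h1 := (hasSum_geometric_of_lt_one ha0 ha1).mul_left (a ^ l)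
  obtain ⟨f, hf⟩ : ∃ f : ℕ → ℝ, f = fun m : ℕ => if l ≤ m then a ^ m else 0 := ⟨_, rfl⟩
  rw [← hf]
  have h3 : (fun m => f (m + l)) = fun i => a ^ l * a ^ i := by
    funext m; rw [hf]; simp [pow_add, mul_comm]
  rw [← h3] at h1
  have h2 : HasSum f (a ^ l * (1 - a)⁻¹ + ∑ i ∈ Finset.range l, f i) :=
    (hasSum_nat_add_iff l).mp h1
  have h4 : ∑ i ∈ Finset.range l, f i = 0 := by
    refine Finset.sum_eq_zero fun i hi => ?_
    have : ¬ l ≤ i := by simpa using hi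
    simp [hf, this]
  rw [h4, add_zero] at h2
  rw [div_eq_mul_inv]
  exact h2

theorem detM13 (N : ℕ) (z t α : ℝ) (e : Fin ((N + 1) / 2) → ℕ) :
    ∃ w : Fin (N + 1) → ℝ, ∀ r, (M13 N z t α e r).det = ∑ k, w k * r k := by
  refine ⟨fun k => (-1) ^ (k : ℕ) *
    ((M13 N z t α e 0).submatrix Fin.succ k.succAbove).det, fun r => ?_⟩
  rw [Matrix.det_succ_row_zero]
  refine Finset.sum_congr rfl fun k _ => ?_
  have hsub : (M13 N z t α e r).submatrix Fin.succ k.succAbove =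
      (M13 N z t α e 0).submatrix Fin.succ k.succAbove := by
    ext i j; simp [M13]
  have h0 : M13 N z t α e r 0 k = r k := by simp [M13]
  rw [hsub, h0]
  ring

theorem hasSum13 (N : ℕ) (z t α : ℝ) (ht : 0 < t) (ht1 : t < 1) (hz : 0 < z)
    (hα : 0 < α) (hαz : α * z < 1) (e : Fin ((N + 1) / 2) → ℕ) :
    HasSum (fun m : ℕ => (M13 N z t α e
        (fun k => if lo13 (N + 1) e 0 ≤ m then (α * z * t ^ (k : ℕ)) ^ m else 0)).det)
      (M13 N z t α e (fun k => (α * z * t ^ (k : ℕ)) ^ (lo13 (N + 1) e 0) /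
        (1 - α * z * t ^ (k : ℕ)))).det := by
  obtain ⟨w, hw⟩ := detM13 N z t α e
  simp only [hw]
  refine hasSum_sum fun k _ => HasSum.mul_left _ (geo13 _ (by positivity) ?_ _)
  have : t ^ (k : ℕ) ≤ 1 := pow_le_one₀ ht.le ht1.le
  have h2 : 0 < α * z := by positivity
  nlinarith

theorem det13 (N : ℕ) (hN : 1 ≤ N) (z t α : ℝ) (ht : 0 < t) (ht1 : t < 1) (hz : 0 < z)
    (hα : 0 < α) (hαz : α * z < 1) (e : Fin ((N + 1) / 2) → ℕ)
    (hP : ∀ i : Fin (N + 1), (i : ℕ) ≠ 0 → lo13 (N + 1) e i ≤ hi13 (N + 1) e i) :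
    (∏ k : Fin (N + 1), (1 - α * z * t ^ (k : ℕ))) *
      (M13 N z t α e (fun k => (α * z * t ^ (k : ℕ)) ^ (lo13 (N + 1) e 0) /
        (1 - α * z * t ^ (k : ℕ)))).det =
    weight13 (N + 1) z t α (fun i => lo13 (N + 1) e i) := by
  have hne : ∀ k : Fin (N + 1), 1 - α * z * t ^ (k : ℕ) ≠ 0 := by
    intro k
    have : t ^ (k : ℕ) ≤ 1 := pow_le_one₀ ht.le ht1.le
    have h2 : 0 < α * z := by positivity
    nlinarith
  rw [weight13_det _ _ _ _ hα, ← Matrix.det_mul_row]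
  symm
  refine Matrix.det_eq_of_forall_row_eq_smul_add_pred
    (fun i => if (i : ℕ) % 2 = 1 then (α * z) ^ lo13 (N + 1) e i / (z / α) ^ lo13 (N + 1) e i
      else α * z * (z / α) ^ lo13 (N + 1) e (i + 1) / (α * z) ^ lo13 (N + 1) e i) ?_ ?_
  · intro k
    simp only [Matrix.of_apply, M13, Fin.val_zero, if_true, co13]
    rw [mul_div_cancel₀ _ (hne k)]
    simp only [Nat.zero_mod, zero_ne_one, if_false]
    rw [mul_pow _ (t ^ (k : ℕ)), ← pow_mul, ← pow_mul, mul_comm (k : ℕ)]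
  · intro i k
    have hi := i.isLt
    have hPi := hP i.succ (by simp)
    have hnek := hne k
    simp only [Matrix.of_apply, M13, Fin.val_succ, Fin.val_castSucc] at hPi ⊢
    rw [if_neg (by omega)]
    have h2 : α * z ≠ 0 := by positivity
    have h3 : z / α ≠ 0 := by positivity
    rcases Nat.mod_two_eq_zero_or_one (i : ℕ) with hp | hp
    · have hhi : hi13 (N + 1) e (i + 1) = lo13 (N + 1) e (i + 1) + 1 := by
        unfold hi13; rw [if_pos (by omega)]
      have hlo : lo13 (N + 1) e i = lo13 (N + 1) e (i + 1) + 1 := by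
        unfold lo13
        rw [if_neg (by omega), if_pos (by omega), if_pos (by omega)]
        congr 2; omega
      rw [hhi, Finset.sum_congr (Nat.Ico_succ_singleton _) (fun _ _ => rfl),
        Finset.sum_singleton, if_neg (by omega)]
      have c1 : co13 z α (i + 1) = z / α := by unfold co13; rw [if_pos (by omega)]
      have c2 : co13 z α i = α * z := by unfold co13; rw [if_neg (by omega)]
      rw [c1, c2, ← mul_assoc (_ / _), div_mul_cancel₀ _ (pow_ne_zero _ h2), hlo]
      ring
    · have hhi : hi13 (N + 1) e (i + 1) = lo13 (N + 1) e i := by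
        unfold hi13; rw [if_neg (by omega)]; rfl
      have c1 : co13 z α (i + 1) = α * z := by unfold co13; rw [if_neg (by omega)]
      have c2 : co13 z α i = z / α := by unfold co13; rw [if_pos (by omega)]
      rw [hhi] at hPi ⊢
      rw [if_pos hp, c1, c2, ← mul_assoc (_ / _), div_mul_cancel₀ _ (pow_ne_zero _ h3)]
      have hr : ∀ x : ℕ, (α * z) ^ x * (t ^ x) ^ (k : ℕ) = (α * z * t ^ (k : ℕ)) ^ x := by
        intro x; rw [mul_pow _ (t ^ (k : ℕ)), ← pow_mul, ← pow_mul, mul_comm x]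
      simp only [hr]
      rw [geom_sum_Ico (fun h => hnek (by rw [h]; ring)) hPi, ← neg_sub 1 (α * z * t ^ (k : ℕ)),
        div_neg, mul_neg, mul_div_cancel₀ _ hnek]
      ring

noncomputable def G13 (N : ℕ) (z t : ℝ) (e : Fin ((N + 1) / 2) → ℕ) : ℝ :=
  if (∀ i : Fin (N + 1), (i : ℕ) ≠ 0 → lo13 (N + 1) e i ≤ hi13 (N + 1) e i) then
    weight13 (N + 1) z t 1 (fun i => lo13 (N + 1) e i) else 0

noncomputable def C13 (N : ℕ) (z t α : ℝ) : ℝ :=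
  α ^ ((N + 1) / 2) / ∏ k : Fin (N + 1), (1 - α * z * t ^ (k : ℕ))

theorem C13_pos (N : ℕ) (z t α : ℝ) (ht : 0 < t) (ht1 : t < 1) (hz : 0 < z)
    (hα : 0 < α) (hαz : α * z < 1) : 0 < C13 N z t α := by
  refine div_pos (by positivity) (Finset.prod_pos fun k _ => ?_)
  have : t ^ (k : ℕ) ≤ 1 := pow_le_one₀ ht.le ht1.le
  have h2 : 0 < α * z := by positivity
  nlinarith

theorem fiber13 (N : ℕ) (hN : 1 ≤ N) (z t α : ℝ) (ht : 0 < t) (ht1 : t < 1) (hz : 0 < z)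
    (hα : 0 < α) (hαz : α * z < 1) (e : Fin ((N + 1) / 2) → ℕ) :
    (∑' h : Fin (N + 1) → ℕ, if StrictAnti h ∧ (∀ i : Fin ((N + 1) / 2),
            h ⟨2 * (i : ℕ) + 1, by have := i.isLt; omega⟩ = e i) then
          ENNReal.ofReal (weight13 (N + 1) z t α h) else 0) =
      ENNReal.ofReal (C13 N z t α) * ENNReal.ofReal (G13 N z t e) := by
  have step : ∀ m : ℕ, (∑' h : Fin (N + 1) → ℕ,
      if (StrictAnti h ∧ (∀ i : Fin ((N + 1) / 2),
            h ⟨2 * (i : ℕ) + 1, by have := i.isLt; omega⟩ = e i)) ∧ h 0 = m then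
          ENNReal.ofReal (weight13 (N + 1) z t α h) else 0) =
      ENNReal.ofReal (∑ h ∈ Fintype.piFinset (A13 (N + 1) e m), weight13 (N + 1) z t α h) := by
    intro m
    rw [ENNReal.ofReal_sum_of_nonneg]
    · rw [tsum_eq_sum (s := Fintype.piFinset (A13 (N + 1) e m))]
      · refine Finset.sum_congr rfl fun h hh => ?_
        rw [if_pos ((mem_A13 N hN e m h).mp hh)]
      · intro h hh
        rw [if_neg (fun H => hh ((mem_A13 N hN e m h).mpr H))]
    · intro h hh
      exact weight13_nonneg _ _ _ _ ht ht1 hz hα _ ((mem_A13 N hN e m h).mp hh).1.1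
  have hnn : ∀ m : ℕ, 0 ≤ ∑ h ∈ Fintype.piFinset (A13 (N + 1) e m),
      weight13 (N + 1) z t α h := by
    intro m
    refine Finset.sum_nonneg fun h hh => ?_
    exact weight13_nonneg _ _ _ _ ht ht1 hz hα _ ((mem_A13 N hN e m h).mp hh).1.1
  have split : (∑' h : Fin (N + 1) → ℕ, if StrictAnti h ∧ (∀ i : Fin ((N + 1) / 2),
            h ⟨2 * (i : ℕ) + 1, by have := i.isLt; omega⟩ = e i) then
          ENNReal.ofReal (weight13 (N + 1) z t α h) else 0) =
      ∑' m : ℕ, ENNReal.ofReal (∑ h ∈ Fintype.piFinset (A13 (N + 1) e m),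
        weight13 (N + 1) z t α h) := by
    simp only [← step]
    rw [ENNReal.tsum_comm]
    refine tsum_congr fun h => ?_
    rw [tsum_eq_single (h 0)]
    · simp
    · intro m hm
      rw [if_neg (fun H => hm H.2.symm)]
  rw [split, ← ENNReal.ofReal_mul (C13_pos N z t α ht ht1 hz hα hαz).le]
  by_cases hP : (∀ i : Fin (N + 1), (i : ℕ) ≠ 0 → lo13 (N + 1) e i ≤ hi13 (N + 1) e i)
  · have hs := hasSum13 N z t α ht ht1 hz hα hαz e
    simp only [← sum13_m N z t α hα e] at hs
    rw [← ENNReal.ofReal_tsum_of_nonneg hnn hs.summable, hs.tsum_eq]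
    congr 1
    have hd := det13 N hN z t α ht ht1 hz hα hαz e hP
    rw [weight13_lo] at hd
    have hpos : (∏ k : Fin (N + 1), (1 - α * z * t ^ (k : ℕ))) ≠ 0 := by
      have h := C13_pos N z t α ht ht1 hz hα hαz
      intro h0
      rw [C13, h0, div_zero] at h
      exact lt_irrefl _ h
    rw [G13, if_pos hP, C13, div_mul_eq_mul_div, ← hd, mul_div_cancel_left₀ _ hpos]
  · rw [G13, if_neg hP, mul_zero, ENNReal.ofReal_zero, ENNReal.tsum_eq_zero]
    intro m
    push Not at hP
    obtain ⟨i, hi, hlt⟩ := hP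
    rw [Finset.sum_eq_zero, ENNReal.ofReal_zero]
    intro h hh
    have := Fintype.mem_piFinset.mp hh i
    rw [A13, if_neg hi, Finset.mem_Ico] at this
    omega

theorem total13 (N : ℕ) (hN : 1 ≤ N) (z t α : ℝ) (ht : 0 < t) (ht1 : t < 1) (hz : 0 < z)
    (hα : 0 < α) (hαz : α * z < 1) :
    (∑' h : Fin (N + 1) → ℕ, if StrictAnti h then
          ENNReal.ofReal (weight13 (N + 1) z t α h) else 0) =
      ENNReal.ofReal (C13 N z t α) *
        ∑' e : Fin ((N + 1) / 2) → ℕ, ENNReal.ofReal (G13 N z t e) := by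
  rw [← ENNReal.tsum_mul_left]
  simp only [← fiber13 N hN z t α ht ht1 hz hα hαz]
  rw [ENNReal.tsum_comm]
  refine tsum_congr fun h => ?_
  rw [tsum_eq_single (fun i : Fin ((N + 1) / 2) =>
    h ⟨2 * (i : ℕ) + 1, by have := i.isLt; omega⟩)]
  · simp
  · intro e he
    rw [if_neg (fun H => he (funext fun i => (H.2 i).symm))]

theorem real13 (n : ℕ) (z t α : ℝ) (ht : 0 < t) (ht1 : t < 1) (hz : 0 < z)
    (hα : 0 < α) (P : (Fin n → ℕ) → Prop) {inst : DecidablePred P} (hP : ∀ h, P h → StrictAnti h) :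
    (∑' h : Fin n → ℕ, if P h then weight13 n z t α h else 0) =
    (∑' h : Fin n → ℕ, if P h then ENNReal.ofReal (weight13 n z t α h) else 0).toReal := by
  rw [ENNReal.tsum_toReal_eq]
  · refine tsum_congr fun h => ?_
    split_ifs with hc
    · rw [ENNReal.toReal_ofReal (weight13_nonneg _ _ _ _ ht ht1 hz hα _ (hP h hc))]
    · simp
  · intro h; split_ifs <;> simp

/-- For the measure on tuples `h_1 > h_2 > ⋯ > h_n ≥ 0` proportional to
`z^{Σ h_j} α^{Σ (-1)^{j-1} h_j} Π_{i<j}(t^{h_j} - t^{h_i})`, the marginal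
distribution of the even-labelled coordinates `h_2, h_4, …` is independent of
`α`: for any two admissible values `α, α'` the normalized marginals agree
(stated with cross-multiplied normalizations). -/
theorem stmt13 (n : ℕ) (hn : 2 ≤ n) (z t α α' : ℝ)
    (ht : 0 < t) (ht1 : t < 1) (hz : 0 < z) (hz1 : z < 1)
    (hα : 0 < α) (hαz : α * z < 1) (hα' : 0 < α') (hα'z : α' * z < 1)
    (hzt : z ^ 2 * t < 1) (e : Fin (n / 2) → ℕ) :
    (∑' h : Fin n → ℕ,
        if StrictAnti h ∧ (∀ i : Fin (n / 2),
            h ⟨2 * (i : ℕ) + 1, by have := i.isLt; omega⟩ = e i) then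
          weight13 n z t α h else 0) *
      (∑' h : Fin n → ℕ, if StrictAnti h then weight13 n z t α' h else 0) =
    (∑' h : Fin n → ℕ,
        if StrictAnti h ∧ (∀ i : Fin (n / 2),
            h ⟨2 * (i : ℕ) + 1, by have := i.isLt; omega⟩ = e i) then
          weight13 n z t α' h else 0) *
      (∑' h : Fin n → ℕ, if StrictAnti h then weight13 n z t α h else 0) := by

  obtain ⟨N, rfl⟩ : ∃ N, n = N + 1 := ⟨n - 1, by omega⟩
  have hN : 1 ≤ N := by omega
  let P : (Fin (N + 1) → ℕ) → Prop := fun h => StrictAnti h ∧ (∀ i : Fin ((N + 1) / 2),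
            h ⟨2 * (i : ℕ) + 1, by have := i.isLt; omega⟩ = e i)
  rw [real13 _ z t α ht ht1 hz hα P (fun h H => H.1),
    real13 _ z t α' ht ht1 hz hα' P (fun h H => H.1),
    real13 _ z t α ht ht1 hz hα StrictAnti (fun h H => H),
    real13 _ z t α' ht ht1 hz hα' StrictAnti (fun h H => H),
    fiber13 N hN z t α ht ht1 hz hα hαz, fiber13 N hN z t α' ht ht1 hz hα' hα'z,
    total13 N hN z t α ht ht1 hz hα hαz, total13 N hN z t α' ht ht1 hz hα' hα'z]
  simp only [ENNReal.toReal_mul]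
  ring
end
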